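/- Let i_n(132) denote the number of 132-avoiding involutions of length n with a unique longest increasing subsequence. Then i_n(132) is asymptotic to 2^{n−1}/(n+1); that is, the limit as n → ∞ of i_n(132)·(n+1)/2^{n−1} equals 1. -/

import Mathlib

/-- `s` is the index set of an increasing subsequence of the word `f`. -/
def IsIncSubseq {n : ℕ} {α : Type*} [Preorder α] (f : Fin n → α) (s : Finset (Fin n)) : Prop :=
  ∀ i ∈ s, ∀ j ∈ s, i < j → f i < f j

/-- `f` has a unique longest increasing subsequence. -/
def HasULIS {n : ℕ} {α : Type*} [Preorder α] (f : Fin n → α) : Prop :=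
  ∃! s : Finset (Fin n), IsIncSubseq f s ∧
    ∀ t : Finset (Fin n), IsIncSubseq f t → t.card ≤ s.card

/-- `p` contains the pattern `q`. -/
def Contains {k n : ℕ} (q : Equiv.Perm (Fin k)) (p : Equiv.Perm (Fin n)) : Prop :=
  ∃ f : Fin k → Fin n, StrictMono f ∧ ∀ a b : Fin k, p (f a) < p (f b) ↔ q a < q b

/-- `p` avoids the pattern `q`. -/
def Avoids {k n : ℕ} (q : Equiv.Perm (Fin k)) (p : Equiv.Perm (Fin n)) : Prop :=
  ¬ Contains q p

def pattern321 : Equiv.Perm (Fin 3) := ⟨![2,1,0], ![2,1,0], by decide, by decide⟩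
def pattern231 : Equiv.Perm (Fin 3) := ⟨![1,2,0], ![2,0,1], by decide, by decide⟩
def pattern132 : Equiv.Perm (Fin 3) := ⟨![0,2,1], ![0,2,1], by decide, by decide⟩
def pattern123 : Equiv.Perm (Fin 3) := Equiv.refl (Fin 3)

/-- the number of `q`-avoiding permutations of length `n` with a unique
longest increasing subsequence. -/
noncomputable def uNum {k : ℕ} (q : Equiv.Perm (Fin k)) (n : ℕ) : ℕ :=
  Nat.card {p : Equiv.Perm (Fin n) // Avoids q p ∧ HasULIS ⇑p}

/-- the number of `q`-avoiding involutions of length `n` with a unique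
longest increasing subsequence. -/
noncomputable def iNum {k : ℕ} (q : Equiv.Perm (Fin k)) (n : ℕ) : ℕ :=
  Nat.card {p : Equiv.Perm (Fin n) // p⁻¹ = p ∧ Avoids q p ∧ HasULIS ⇑p}

/-- A permutation is indecomposable if it cannot be cut into a (nonempty) prefix and
a (nonempty) suffix so that every entry of the prefix is smaller than every entry
of the suffix. -/
def Indecomposable {m : ℕ} (w : Equiv.Perm (Fin m)) : Prop :=
  ¬ ∃ j : ℕ, 1 ≤ j ∧ j < m ∧ ∀ a b : Fin m, (a : ℕ) < j → j ≤ (b : ℕ) → w a < w b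

/-- The word `f` avoids the pattern `132`. -/
def Avoids132 {n : ℕ} (f : Fin n → Fin n) : Prop :=
  ∀ i j k, i < j → j < k → f i < f k → ¬ f k < f j

/-- The number of entries of `f` to the right of and above the entry at position `i`. -/
def upperRight {n : ℕ} (f : Fin n → Fin n) (i : Fin n) : ℕ :=
  ∑ j, if i < j ∧ f i < f j then 1 else 0

/-- The `a` largest values of `f` occur in increasing order. -/
def TopIncreasing {n : ℕ} (a : ℕ) (f : Fin n → Fin n) : Prop :=
  ∀ i j, i < j → n ≤ f i + a → n ≤ f j + a → f i < f j

/-- `upperRight f` has a unique maximum, and its value is `x - 1`. -/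
def UniquePeak {n : ℕ} (x : ℕ) (f : Fin n → Fin n) : Prop :=
  ∃ i₀, upperRight f i₀ + 1 = x ∧ ∀ i, i ≠ i₀ → upperRight f i + 1 < x

/-- Insert the two-cycle `(0, b + 1)` into the involution `f`. -/
def insertCycle {m : ℕ} (b : Fin (m + 1)) (f : Fin m → Fin m) : Fin (m + 2) → Fin (m + 2) :=
  Fin.cons b.succ (Fin.insertNth (α := fun _ => Fin (m + 2)) b 0 fun j => (b.succAbove (f j)).succ)

section insertCycle

variable {m : ℕ} (b : Fin (m + 1)) (f : Fin m → Fin m)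

@[simp] lemma insertCycle_zero : insertCycle b f 0 = b.succ := rfl

@[simp] lemma insertCycle_succ_self : insertCycle b f b.succ = 0 := by
  simp [insertCycle]

@[simp] lemma insertCycle_succAbove (j : Fin m) :
    insertCycle b f (b.succAbove j).succ = (b.succAbove (f j)).succ := by
  simp [insertCycle]

/-- Case analysis on `Fin (m + 2)`, singling out `0` and `b + 1`. -/
lemma forall_fin_insertCycle {P : Fin (m + 2) → Prop} :
    (∀ i, P i) ↔ P 0 ∧ P b.succ ∧ ∀ j, P (b.succAbove j).succ := by
  rw [Fin.forall_fin_succ, Fin.forall_iff_succAbove b]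

lemma insertCycle_injective : Function.Injective (insertCycle b) := by
  intro f g h
  funext j
  have := congrFun h (b.succAbove j).succ
  simpa using this

lemma involutive_insertCycle :
    Function.Involutive (insertCycle b f) ↔ Function.Involutive f := by
  unfold Function.Involutive
  rw [forall_fin_insertCycle b]
  simp

lemma exists_insertCycle {g : Fin (m + 2) → Fin (m + 2)} (hg : Function.Involutive g)
    (h0 : g 0 = b.succ) : ∃ f, insertCycle b f = g := by
  have hb : g b.succ = 0 := by rw [← h0, hg]
  have key : ∀ j : Fin m, ∃ k : Fin m, g (b.succAbove j).succ = (b.succAbove k).succ := by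
    intro j
    have h1 : g (b.succAbove j).succ ≠ 0 := fun h => by
      have := hg.injective (h.trans hb.symm)
      simp at this
    obtain ⟨y, hy⟩ := Fin.exists_succ_eq.2 h1
    have h2 : y ≠ b := fun h => by
      have := hg.injective (hy.symm.trans (h ▸ h0.symm))
      simp at this
    obtain ⟨z, hz⟩ := Fin.exists_succAbove_eq h2
    exact ⟨z, by rw [hz, hy]⟩
  choose f hf using key
  refine ⟨f, ?_⟩
  funext i
  revert i
  rw [forall_fin_insertCycle b]
  simp [h0, hb, hf]

lemma le_val_succAbove_add (v : Fin m) :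
    m + 1 ≤ (b.succAbove v : ℕ) + (m - b) ↔ m ≤ (v : ℕ) + (m - b) := by
  have := b.2
  have := v.2
  rcases lt_or_ge (v.castSucc) b with h | h
  · rw [Fin.succAbove_of_castSucc_lt _ _ h]
    simp only [Fin.lt_def, Fin.val_castSucc] at h ⊢
    omega
  · rw [Fin.succAbove_of_le_castSucc _ _ h]
    simp only [Fin.le_def, Fin.val_castSucc, Fin.val_succ] at h ⊢
    omega

lemma lt_succAbove_iff (v : Fin m) : b < b.succAbove v ↔ m ≤ (v : ℕ) + (m - b) := by
  rw [Fin.lt_succAbove_iff_le_castSucc, Fin.le_def, Fin.val_castSucc]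
  omega

variable {b f}

lemma avoids132_insertCycle (hf : Function.Involutive f) :
    Avoids132 (insertCycle b f) ↔ Avoids132 f ∧ TopIncreasing (m - b) f := by
  constructor
  · intro h
    refine ⟨fun i j k hij hjk h1 h2 => ?_, fun i j hij h1 h2 => ?_⟩
    · refine h (b.succAbove i).succ (b.succAbove j).succ (b.succAbove k).succ ?_ ?_ ?_ ?_ <;>
        simpa
    · have := h 0 (b.succAbove i).succ (b.succAbove j).succ (by simp) (by simpa)
        (by simpa [lt_succAbove_iff])
      have h3 : f i ≠ f j := fun h => hij.ne (hf.injective h)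
      simp at this
      exact lt_of_le_of_ne this h3
  · rintro ⟨h1, h2⟩
    unfold Avoids132
    rw [forall_fin_insertCycle b]
    refine ⟨?_, ?_, fun i => ?_⟩
    · rw [forall_fin_insertCycle b]
      refine ⟨by simp, ?_, fun j => ?_⟩
      · simp
      · rw [forall_fin_insertCycle b]
        simp only [insertCycle_zero, insertCycle_succ_self, insertCycle_succAbove]
        refine ⟨by simp, by simp, fun k => ?_⟩
        simp only [Fin.succ_lt_succ_iff, lt_succAbove_iff, Fin.succAbove_lt_succAbove_iff]
        intro _ hjk hk hkj
        exact absurd (h2 j k hjk (by have := Fin.lt_def.1 hkj; omega) hk) (not_lt.2 hkj.le)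
    · rw [forall_fin_insertCycle b]
      refine ⟨by simp, by simp, fun j => ?_⟩
      rw [forall_fin_insertCycle b]
      simp only [insertCycle_zero, insertCycle_succ_self, insertCycle_succAbove]
      refine ⟨by simp, by simp, fun k => ?_⟩
      simp only [Fin.succ_lt_succ_iff, lt_succAbove_iff, Fin.succAbove_lt_succAbove_iff]
      intro hj hjk _ hkj
      have := h2 (f k) (f j) hkj (by rw [hf]; have := Fin.lt_def.1 hjk; omega) (by rwa [hf])
      rw [hf, hf] at this
      exact absurd this (not_lt.2 hjk.le)
    · rw [forall_fin_insertCycle b]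
      refine ⟨by simp, ?_, fun j => ?_⟩
      · simp
      · rw [forall_fin_insertCycle b]
        refine ⟨by simp, by simp, fun k => ?_⟩
        simpa using fun a b c => not_lt.1 (h1 i j k a b c)

lemma upperRight_insertCycle_succAbove (j : Fin m) :
    upperRight (insertCycle b f) (b.succAbove j).succ = upperRight f j := by
  unfold upperRight
  rw [Fin.sum_univ_succ, Fin.sum_univ_succAbove _ b]
  simp

lemma upperRight_insertCycle_succ_self :
    upperRight (insertCycle b f) b.succ = m - b := by
  unfold upperRight
  have : ∀ j, (b.succ < j ∧ insertCycle b f b.succ < insertCycle b f j) ↔ b.succ < j := by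
    rw [forall_fin_insertCycle b]
    simp
  simp only [this, Finset.sum_boole, Finset.filter_lt_eq_Ioi, Fin.card_Ioi]
  simp

lemma upperRight_insertCycle_zero (hf : Function.Involutive f) :
    upperRight (insertCycle b f) 0 = m - b := by
  unfold upperRight
  have : ∀ j, (0 < j ∧ insertCycle b f 0 < insertCycle b f j) ↔
      b.succ < insertCycle b f j := by
    rw [forall_fin_insertCycle b]
    simp
  simp only [this]
  have hi := (involutive_insertCycle b f).2 hf
  refine (Equiv.sum_comp hi.toPerm (fun j => if b.succ < j then 1 else 0)).trans ?_
  simp only [Finset.sum_boole, Finset.filter_lt_eq_Ioi, Fin.card_Ioi]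
  simp

lemma uniquePeak_insertCycle (hf : Function.Involutive f) (x : ℕ) :
    UniquePeak x (insertCycle b f) ↔ UniquePeak x f ∧ m - b + 1 < x := by
  constructor
  · rintro ⟨i, hi, h⟩
    rw [forall_fin_insertCycle b] at h
    simp only [upperRight_insertCycle_zero hf, upperRight_insertCycle_succ_self,
      upperRight_insertCycle_succAbove] at h
    obtain ⟨h0, hb, hj⟩ := h
    revert hi h0 hb hj
    revert i
    rw [forall_fin_insertCycle b]
    simp only [upperRight_insertCycle_zero hf, upperRight_insertCycle_succ_self,
      upperRight_insertCycle_succAbove]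
    refine ⟨?_, ?_, fun j hi h0 hb hj => ⟨⟨j, hi, fun i hij => hj i ?_⟩, h0 ?_⟩⟩
    · intro h1 _ h2 _
      have := h2 (Fin.succ_ne_zero _)
      omega
    · intro h1 h2 _ _
      have := h2 (Fin.succ_ne_zero _).symm
      omega
    · simpa using hij
    · exact (Fin.succ_ne_zero _).symm
  · rintro ⟨⟨i, hi, h⟩, hx⟩
    refine ⟨(b.succAbove i).succ, by simpa [upperRight_insertCycle_succAbove] using hi, ?_⟩
    rw [forall_fin_insertCycle b]
    simp only [upperRight_insertCycle_zero hf, upperRight_insertCycle_succ_self,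
      upperRight_insertCycle_succAbove]
    refine ⟨fun _ => hx, fun _ => hx, fun j hj => h j ?_⟩
    rintro rfl
    exact hj rfl

lemma topIncreasing_insertCycle (hf : TopIncreasing (m - b) f) (hi : Function.Involutive f)
    (a : ℕ) : TopIncreasing a (insertCycle b f) ↔ a ≤ m - b + 1 := by
  have hb := b.2
  constructor
  · intro h
    by_contra! ha
    have h0 := (involutive_insertCycle b f).2 hi (b.castSucc)
    have hne : insertCycle b f b.castSucc ≠ 0 := by
      intro h'
      rw [h', insertCycle_zero] at h0
      exact absurd h0 (by simp [Fin.ext_iff])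
    have := h 0 (insertCycle b f b.castSucc) (Fin.pos_iff_ne_zero.2 hne)
      (by simp; omega) (by rw [h0]; simp; omega)
    rw [h0, insertCycle_zero, Fin.lt_def] at this
    simp at this
  · intro ha
    unfold TopIncreasing
    rw [forall_fin_insertCycle b]
    refine ⟨?_, ?_, fun i => ?_⟩
    · rw [forall_fin_insertCycle b]
      refine ⟨by simp, ?_, fun j => ?_⟩
      · simp; omega
      · simp only [insertCycle_zero, insertCycle_succAbove, Fin.succ_lt_succ_iff, Fin.val_succ,
          lt_succAbove_iff, ← le_val_succAbove_add]
        intro _ _ h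
        have := Fin.succAbove_ne b (f j)
        rw [Ne, Fin.ext_iff] at this
        omega
    · simp only [insertCycle_succ_self, Fin.val_zero]
      intro j _ h
      omega
    · rw [forall_fin_insertCycle b]
      refine ⟨by simp, ?_, fun j => ?_⟩
      · simp; omega
      · simp only [insertCycle_succAbove, Fin.succ_lt_succ_iff, Fin.val_succ,
          Fin.succAbove_lt_succAbove_iff]
        intro hij h1 h2
        have h3 := Fin.succAbove_ne b (f i)
        have h4 := Fin.succAbove_ne b (f j)
        rw [Ne, Fin.ext_iff] at h3 h4
        exact hf i j hij ((le_val_succAbove_add b _).1 (by omega))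
          ((le_val_succAbove_add b _).1 (by omega))

end insertCycle

lemma topIncreasing_id {n a : ℕ} : TopIncreasing a (id : Fin n → Fin n) := fun _ _ h _ _ => h

lemma avoids132_id {n : ℕ} : Avoids132 (id : Fin n → Fin n) :=
  fun _ _ _ _ h _ => not_lt.2 (le_of_lt h)

lemma upperRight_id {n : ℕ} (i : Fin n) : upperRight id i = n - 1 - i := by
  simp [upperRight, Finset.filter_lt_eq_Ioi]

lemma uniquePeak_id {n x : ℕ} : UniquePeak x (id : Fin (n + 1) → Fin (n + 1)) ↔ x = n + 1 := by
  simp only [UniquePeak, upperRight_id]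
  constructor
  · rintro ⟨i, hi, h⟩
    by_cases h0 : i = 0
    · subst h0; simp at hi; omega
    · have := h 0 (Ne.symm h0)
      simp at this; omega
  · rintro rfl
    refine ⟨0, by simp, fun i hi => ?_⟩
    have : (i : ℕ) ≠ 0 := fun h => hi (Fin.ext h)
    omega

lemma eq_id_of_avoids132 {n : ℕ} {f : Fin (n + 1) → Fin (n + 1)} (hf : Function.Injective f)
    (h : Avoids132 f) (h0 : f 0 = 0) : f = id := by
  have hm : StrictMono f := by
    intro i j hij
    rcases eq_or_ne i 0 with rfl | hi
    · rw [h0, Fin.pos_iff_ne_zero]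
      intro hj
      exact hij.ne (hf (h0.trans hj.symm))
    · have := h 0 i j (Fin.pos_iff_ne_zero.2 hi) hij (by
        rw [h0, Fin.pos_iff_ne_zero]
        intro hj
        exact (Fin.pos_iff_ne_zero.1 (lt_of_le_of_lt (Fin.zero_le _) hij))
          (hf (hj.trans h0.symm)))
      exact lt_of_le_of_ne (not_lt.1 this) fun h => hij.ne (hf h)
  have := Subsingleton.elim
    (hm.orderIsoOfSurjective f (Finite.injective_iff_surjective.1 hf)) (OrderIso.refl _)
  funext i
  exact DFunLike.congr_fun this i

open Classical in
/-- The `132`-avoiding involutions `f` of length `n` whose `upperRight` statistic has unique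
maximum `x - 1` and whose `a` largest values are in increasing order. -/
noncomputable def peakInvolutions (n x a : ℕ) : Finset (Fin n → Fin n) :=
  {f | Function.Involutive f ∧ Avoids132 f ∧ UniquePeak x f ∧ TopIncreasing a f}

lemma mem_peakInvolutions {n x a : ℕ} {f : Fin n → Fin n} : f ∈ peakInvolutions n x a ↔
    Function.Involutive f ∧ Avoids132 f ∧ UniquePeak x f ∧ TopIncreasing a f := by
  simp [peakInvolutions]

lemma peakInvolutions_zero (x a : ℕ) : peakInvolutions 0 x a = ∅ := by
  ext f
  rw [mem_peakInvolutions]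
  simp [UniquePeak]

lemma upperRight_add_lt {n : ℕ} (f : Fin n → Fin n) (i : Fin n) : upperRight f i + i < n := by
  have : upperRight f i ≤ n - 1 - i := by
    rw [← upperRight_id i]
    unfold upperRight
    refine Finset.sum_le_sum fun j _ => ?_
    simp only [id]
    split_ifs with h1 h2 <;> simp_all
  omega

lemma peakInvolutions_of_lt {n x a : ℕ} (h : n < x) : peakInvolutions n x a = ∅ := by
  ext f
  rw [mem_peakInvolutions]
  simp only [Finset.notMem_empty, iff_false, not_and]
  rintro - - ⟨i, hi, -⟩
  have := upperRight_add_lt f i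
  omega

lemma card_filter_zero (n x a : ℕ) :
    ((peakInvolutions (n + 1) x a).filter fun f => f 0 = 0).card = if x = n + 1 then 1 else 0 := by
  have : (peakInvolutions (n + 1) x a).filter (fun f => f 0 = 0) =
      if x = n + 1 then {id} else ∅ := by
    ext f
    rw [Finset.mem_filter, mem_peakInvolutions]
    constructor
    · rintro ⟨⟨h1, h2, h3, h4⟩, h5⟩
      have := eq_id_of_avoids132 h1.injective h2 h5
      subst this
      rw [uniquePeak_id] at h3
      simp [h3]
    · intro h
      split_ifs at h with hx
      · rw [Finset.mem_singleton] at h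
        subst h
        exact ⟨⟨fun _ => rfl, avoids132_id, uniquePeak_id.2 hx, topIncreasing_id⟩, rfl⟩
      · simp at h
  rw [this]
  split_ifs <;> simp

lemma card_peakInvolutions_one (x a : ℕ) :
    (peakInvolutions 1 x a).card = if x = 1 then 1 else 0 := by
  rw [← card_filter_zero 0 x a, Finset.filter_true_of_mem]
  intro f _
  exact Subsingleton.elim (α := Fin 1) _ _

lemma card_filter_succ (n x a : ℕ) (b : Fin (n + 1)) :
    ((peakInvolutions (n + 2) x a).filter fun f => f 0 = b.succ).card =
      if n - b + 1 < x ∧ a ≤ n - b + 1 then (peakInvolutions n x (n - b)).card else 0 := by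
  have : (peakInvolutions (n + 2) x a).filter (fun f => f 0 = b.succ) =
      if n - b + 1 < x ∧ a ≤ n - b + 1 then
        (peakInvolutions n x (n - b)).map ⟨insertCycle b, insertCycle_injective b⟩ else ∅ := by
    ext f
    rw [Finset.mem_filter, mem_peakInvolutions]
    constructor
    · rintro ⟨⟨h1, h2, h3, h4⟩, h5⟩
      obtain ⟨f, rfl⟩ := exists_insertCycle b h1 h5
      rw [involutive_insertCycle] at h1
      rw [avoids132_insertCycle h1] at h2
      rw [uniquePeak_insertCycle h1] at h3
      rw [topIncreasing_insertCycle h2.2 h1] at h4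
      rw [if_pos ⟨h3.2, h4⟩, Finset.mem_map]
      exact ⟨f, mem_peakInvolutions.2 ⟨h1, h2.1, h3.1, h2.2⟩, rfl⟩
    · intro h
      split_ifs at h with hx
      · rw [Finset.mem_map] at h
        obtain ⟨f, hf, rfl⟩ := h
        obtain ⟨h1, h2, h3, h4⟩ := mem_peakInvolutions.1 hf
        exact ⟨⟨(involutive_insertCycle b f).2 h1, (avoids132_insertCycle h1).2 ⟨h2, h4⟩,
          (uniquePeak_insertCycle h1 x).2 ⟨h3, hx.1⟩,
          (topIncreasing_insertCycle h4 h1 a).2 hx.2⟩, rfl⟩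
      · simp at h
  rw [this]
  split_ifs <;> simp

lemma card_peakInvolutions_add_two (n x a : ℕ) :
    (peakInvolutions (n + 2) x a).card = (if x = n + 2 then 1 else 0) +
      ∑ c ∈ Finset.range (n + 1),
        if c + 1 < x ∧ a ≤ c + 1 then (peakInvolutions n x c).card else 0 := by
  rw [Finset.card_eq_sum_card_fiberwise (f := fun f => f 0) (t := Finset.univ)
    (fun _ _ => Finset.mem_univ _), Fin.sum_univ_succ]
  simp only [card_filter_zero, card_filter_succ]
  congr 1
  rw [Fin.sum_univ_eq_sum_range (fun b => if n - b + 1 < x ∧ a ≤ n - b + 1 then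
    (peakInvolutions n x (n - b)).card else 0),
    ← Finset.sum_range_reflect]
  refine Finset.sum_congr rfl fun c hc => ?_
  have : n - (n + 1 - 1 - c) = c := by
    have := Finset.mem_range.1 hc
    omega
  rw [this]

/-- Adding a step to a walk. -/
lemma card_peakInvolutions_succ (n x a : ℕ) (ha : a + 1 < x) (hn : a < n + 1) :
    (peakInvolutions (n + 2) x (a + 1)).card =
      (peakInvolutions (n + 2) x (a + 2)).card + (peakInvolutions n x a).card := by
  rw [card_peakInvolutions_add_two, card_peakInvolutions_add_two, add_assoc]
  congr 1
  rw [← Finset.sum_ite_eq_of_mem' (Finset.range (n + 1)) a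
    (fun c => (peakInvolutions n x c).card) (Finset.mem_range.2 hn), ← Finset.sum_add_distrib]
  refine Finset.sum_congr rfl fun c _ => ?_
  by_cases h : c = a
  · subst h
    simp [ha]
  · have : a + 1 ≤ c + 1 ↔ a + 2 ≤ c + 1 := by omega
    simp [h, this]

lemma card_peakInvolutions_zero (n x : ℕ) :
    (peakInvolutions n x 0).card = (peakInvolutions n x 1).card := by
  rcases n with _ | _ | n
  · simp [peakInvolutions_zero]
  · simp [card_peakInvolutions_one]
  · simp [card_peakInvolutions_add_two]

lemma card_peakInvolutions_self (n x : ℕ) :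
    (peakInvolutions n x x).card = if x = n ∧ x ≠ 0 then 1 else 0 := by
  rcases n with _ | _ | n
  · by_cases h : x = 0 <;> simp [peakInvolutions_zero, h]
  · rw [zero_add, card_peakInvolutions_one]
    congr 1
    simp only [ne_eq, eq_iff_iff]
    omega
  · rw [card_peakInvolutions_add_two, Finset.sum_eq_zero]
    · simp; congr 1; simp; omega
    · intro c _
      rw [if_neg]
      omega

lemma card_peakInvolutions_of_eq (n a : ℕ) :
    (peakInvolutions (n + 1) (n + 1) a).card = 1 := by
  rcases n with _ | n
  · simp [card_peakInvolutions_one]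
  · rw [card_peakInvolutions_add_two, Finset.sum_eq_zero]
    · simp
    · intro c _
      rw [peakInvolutions_of_lt (by omega)]
      simp

/-- The sum of `φ` over the endpoints of all `2 ^ m` walks of length `m` on `ℤ` starting at `0`
with steps `± 1`. -/
def walkSum : ℕ → (ℤ → ℝ) → ℝ
  | 0, φ => φ 0
  | m + 1, φ => walkSum m fun y => φ (y + 1) + φ (y - 1)

lemma walkSum_zero (φ : ℤ → ℝ) : walkSum 0 φ = φ 0 := rfl

lemma walkSum_succ (m : ℕ) (φ : ℤ → ℝ) :
    walkSum (m + 1) φ = walkSum m fun y => φ (y + 1) + φ (y - 1) := rfl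

lemma walkSum_congr {m : ℕ} {φ ψ : ℤ → ℝ}
    (h : ∀ y : ℤ, |y| ≤ m → (2 : ℤ) ∣ y - m → φ y = ψ y) : walkSum m φ = walkSum m ψ := by
  induction m generalizing φ ψ with
  | zero => exact h 0 (by simp) (by simp)
  | succ m ih =>
    refine ih fun y hy h2 => ?_
    rw [abs_le] at hy
    push_cast at h
    rw [h (y + 1) (abs_le.2 ⟨by omega, by omega⟩) (by omega),
      h (y - 1) (abs_le.2 ⟨by omega, by omega⟩) (by omega)]

lemma walkSum_add (m : ℕ) (φ ψ : ℤ → ℝ) :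
    walkSum m (fun y => φ y + ψ y) = walkSum m φ + walkSum m ψ := by
  induction m generalizing φ ψ with
  | zero => rfl
  | succ m ih =>
    simp only [walkSum_succ, ← ih]
    congr 1
    funext y
    ring

lemma walkSum_const_mul (m : ℕ) (r : ℝ) (φ : ℤ → ℝ) :
    walkSum m (fun y => r * φ y) = r * walkSum m φ := by
  induction m generalizing φ with
  | zero => rfl
  | succ m ih => simp only [walkSum_succ, ← ih, mul_add]

lemma walkSum_neg (m : ℕ) (φ : ℤ → ℝ) :
    walkSum m (fun y => -φ y) = -walkSum m φ := by
  simpa using walkSum_const_mul m (-1) φ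

lemma walkSum_sub (m : ℕ) (φ ψ : ℤ → ℝ) :
    walkSum m (fun y => φ y - ψ y) = walkSum m φ - walkSum m ψ := by
  simp only [sub_eq_add_neg, walkSum_add, walkSum_neg]

lemma walkSum_sum {ι : Type*} (s : Finset ι) (m : ℕ) (φ : ι → ℤ → ℝ) :
    walkSum m (fun y => ∑ i ∈ s, φ i y) = ∑ i ∈ s, walkSum m (φ i) := by
  classical
  induction s using Finset.induction_on with
  | empty => simpa using walkSum_const_mul m 0 0
  | insert i s hi ih => simp only [Finset.sum_insert hi, walkSum_add, ih]

lemma walkSum_comp_neg (m : ℕ) (φ : ℤ → ℝ) :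
    walkSum m (fun y => φ (-y)) = walkSum m φ := by
  induction m generalizing φ with
  | zero => simp [walkSum_zero]
  | succ m ih =>
    rw [walkSum_succ, walkSum_succ, ← ih (fun y => φ (y + 1) + φ (y - 1))]
    congr 1
    funext y
    rw [add_comm]
    congr 2 <;> ring

lemma walkSum_eq_zero_of_odd (m : ℕ) (φ : ℤ → ℝ) (h : ∀ y, φ (-y) = -φ y) :
    walkSum m φ = 0 := by
  have h1 := walkSum_comp_neg m φ
  simp only [h, walkSum_neg] at h1
  linarith

/-- The initial data, extended by reflection, for walks confined to an interval of
`H - 1` points. -/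
noncomputable def reflectedData (H : ℕ) (y : ℤ) : ℝ :=
  (if 2 * (H : ℤ) ∣ y + 2 - H then 1 else 0) - if 2 * (H : ℤ) ∣ y - H then 1 else 0

lemma walkSum_reflectedData_left (H m : ℕ) :
    walkSum m (fun z => reflectedData H (-1 + z)) = 0 := by
  refine walkSum_eq_zero_of_odd _ _ fun y => ?_
  have h1 : 2 * (H : ℤ) ∣ -1 + -y + 2 - H ↔ 2 * (H : ℤ) ∣ -1 + y - H := by
    rw [← dvd_neg, ← dvd_sub_self_right]; ring_nf
  have h2 : 2 * (H : ℤ) ∣ -1 + -y - H ↔ 2 * (H : ℤ) ∣ -1 + y + 2 - H := by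
    rw [← dvd_neg, ← dvd_sub_self_right]; ring_nf
  simp only [reflectedData, h1, h2]
  ring

lemma walkSum_reflectedData_right (H m : ℕ) :
    walkSum m (fun z => reflectedData H (H - 1 + z)) = 0 := by
  refine walkSum_eq_zero_of_odd _ _ fun y => ?_
  have h1 : 2 * (H : ℤ) ∣ H - 1 + -y + 2 - H ↔ 2 * (H : ℤ) ∣ H - 1 + y - H := by
    rw [← dvd_neg]; ring_nf
  have h2 : 2 * (H : ℤ) ∣ H - 1 + -y - H ↔ 2 * (H : ℤ) ∣ H - 1 + y + 2 - H := by
    rw [← dvd_neg]; ring_nf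
  simp only [reflectedData, h1, h2]
  ring

lemma reflectedData_of_lt {x a : ℕ} (h : a < x) :
    reflectedData (x + 1) a = if a + 1 = x then 1 else 0 := by
  have h1 : ¬ 2 * ((x + 1 : ℕ) : ℤ) ∣ (a : ℤ) - (x + 1 : ℕ) := fun h => by
    have := Int.eq_zero_of_abs_lt_dvd h (by rw [abs_lt]; push_cast; omega)
    push_cast at this
    omega
  have h2 : 2 * ((x + 1 : ℕ) : ℤ) ∣ (a : ℤ) + 2 - (x + 1 : ℕ) ↔ a + 1 = x := by
    constructor
    · intro h
      have := Int.eq_zero_of_abs_lt_dvd h (by rw [abs_lt]; push_cast; omega)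
      push_cast at this
      omega
    · rintro rfl
      push_cast
      ring_nf
      simp
  simp only [reflectedData, h1, h2]
  simp

lemma card_peakInvolutions_eq_walkSum (s x a : ℕ) (ha : a < x) :
    ((peakInvolutions (s + 1 + a) x a).card : ℝ) =
      walkSum s fun z => reflectedData (x + 1) (a + z) := by
  induction s generalizing a with
  | zero =>
    rw [walkSum_zero, add_zero, reflectedData_of_lt ha]
    split_ifs with h
    · subst h
      rw [zero_add, add_comm 1, card_peakInvolutions_of_eq, Nat.cast_one]
    · rw [peakInvolutions_of_lt (by omega)]
      simp
  | succ s ih =>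
    have key : ∀ b : ℕ, b ≤ x → b ≠ 0 → ((peakInvolutions (s + 1 + b) x b).card : ℝ) =
        walkSum s fun z => reflectedData (x + 1) (b + z) := by
      intro b hb hb0
      rcases hb.lt_or_eq with hb | rfl
      · exact ih b hb
      · have := walkSum_reflectedData_right (b + 1) s
        rw [card_peakInvolutions_self, if_neg (by omega)]
        push_cast at this
        simpa using this.symm
    have h1 : (walkSum (s + 1) fun z => reflectedData (x + 1) (a + z)) =
        (walkSum s fun z => reflectedData (x + 1) ((a + 1 : ℕ) + z)) +
        walkSum s fun z => reflectedData (x + 1) ((a - 1 : ℤ) + z) := by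
      rw [walkSum_succ, ← walkSum_add]
      congr 1
      funext z
      push_cast
      congr 2 <;> ring
    rw [h1, ← key (a + 1) (by omega) (by omega)]
    rcases a with _ | a
    · have := walkSum_reflectedData_left (x + 1) s
      simp only [Nat.cast_zero, zero_sub, this, add_zero]
      rw [card_peakInvolutions_zero]
    · have h2 : s + 1 + 1 + (a + 1) = (s + 1 + a) + 2 := by ring
      rw [h2, card_peakInvolutions_succ _ _ _ ha (by omega)]
      have h3 := ih a (by omega)
      push_cast at h3 ⊢
      rw [h3]
      congr 1
      congr 2
      ring_nf

/-- The increasing chain formed by an entry and everything to its upper right. -/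
def upperChain {n : ℕ} (f : Fin n → Fin n) (i : Fin n) : Finset (Fin n) :=
  insert i (Finset.univ.filter fun j => i < j ∧ f i < f j)

lemma mem_upperChain {n : ℕ} {f : Fin n → Fin n} {i j : Fin n} :
    j ∈ upperChain f i ↔ j = i ∨ i < j ∧ f i < f j := by
  simp [upperChain]

lemma card_upperChain {n : ℕ} (f : Fin n → Fin n) (i : Fin n) :
    (upperChain f i).card = upperRight f i + 1 := by
  rw [upperChain, Finset.card_insert_of_notMem (by simp), upperRight, Finset.card_filter]

lemma isIncSubseq_upperChain {n : ℕ} {f : Fin n → Fin n} (hf : Function.Injective f)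
    (h : Avoids132 f) (i : Fin n) : IsIncSubseq f (upperChain f i) := by
  intro j hj k hk hjk
  rw [mem_upperChain] at hj hk
  rcases hj with rfl | hj
  · rcases hk with rfl | hk
    · exact absurd hjk (lt_irrefl _)
    · exact hk.2
  · rcases hk with rfl | hk
    · exact absurd hjk (not_lt.2 hj.1.le)
    · exact lt_of_le_of_ne (not_lt.1 (h i j k hj.1 hjk hk.2)) fun h => hjk.ne (hf h)

lemma subset_upperChain {n : ℕ} {f : Fin n → Fin n} {s : Finset (Fin n)} (hs : IsIncSubseq f s)
    (h : s.Nonempty) : s ⊆ upperChain f (s.min' h) := by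
  intro j hj
  rw [mem_upperChain]
  rcases (s.min'_le j hj).eq_or_lt with h1 | h1
  · exact Or.inl h1.symm
  · exact Or.inr ⟨h1, hs _ (s.min'_mem h) _ hj h1⟩

lemma upperChain_injective {n : ℕ} {f : Fin n → Fin n} : Function.Injective (upperChain f) := by
  intro i j h
  have h1 : i ∈ upperChain f j := h ▸ mem_upperChain.2 (Or.inl rfl)
  have h2 : j ∈ upperChain f i := h ▸ mem_upperChain.2 (Or.inl rfl)
  rw [mem_upperChain] at h1 h2
  rcases h1 with h1 | h1
  · exact h1
  · rcases h2 with h2 | h2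
    · exact h2.symm
    · exact absurd h1.1 (not_lt.2 h2.1.le)

lemma hasULIS_iff {n : ℕ} (hn : 0 < n) {f : Fin n → Fin n} (hf : Function.Injective f)
    (h : Avoids132 f) : HasULIS f ↔ ∃ x, UniquePeak x f := by
  constructor
  · rintro ⟨s, ⟨hs, hmax⟩, huniq⟩
    have hne : s.Nonempty := by
      have := hmax _ (isIncSubseq_upperChain hf h ⟨0, hn⟩)
      rw [card_upperChain] at this
      exact Finset.card_pos.1 (by omega)
    have heq : s = upperChain f (s.min' hne) :=
      Finset.eq_of_subset_of_card_le (subset_upperChain hs hne)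
        (hmax _ (isIncSubseq_upperChain hf h _))
    refine ⟨s.card, s.min' hne, ?_, fun i hi => ?_⟩
    · rw [← card_upperChain, ← heq]
    · rw [← card_upperChain]
      refine lt_of_le_of_ne (hmax _ (isIncSubseq_upperChain hf h _)) fun hc => hi ?_
      have := huniq (upperChain f i) ⟨isIncSubseq_upperChain hf h _, fun t ht =>
        hc ▸ hmax t ht⟩
      exact upperChain_injective (this.trans heq)
  · rintro ⟨x, i, hi, hx⟩
    have hle : ∀ j, (upperChain f j).card ≤ (upperChain f i).card := by
      intro j
      rw [card_upperChain, card_upperChain, hi]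
      by_cases hj : j = i
      · rw [hj, hi]
      · exact (hx j hj).le
    have hmax : ∀ t, IsIncSubseq f t → t.card ≤ (upperChain f i).card := by
      intro t ht
      rcases t.eq_empty_or_nonempty with rfl | hne
      · simp
      · exact (Finset.card_le_card (subset_upperChain ht hne)).trans (hle _)
    refine ⟨upperChain f i, ⟨isIncSubseq_upperChain hf h i, hmax⟩, ?_⟩
    rintro t ⟨ht, htmax⟩
    have hcard := htmax _ (isIncSubseq_upperChain hf h i)
    have hne : t.Nonempty := by
      rw [card_upperChain] at hcard
      exact Finset.card_pos.1 (by omega)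
    have hsub := subset_upperChain ht hne
    have hmin : t.min' hne = i := by
      by_contra hc
      have h1 := hx _ hc
      have h2 := Finset.card_le_card hsub
      rw [card_upperChain] at hcard h2
      omega
    rw [hmin] at hsub
    exact Finset.eq_of_subset_of_card_le hsub hcard

lemma avoids_pattern132_iff {n : ℕ} (p : Equiv.Perm (Fin n)) :
    Avoids pattern132 p ↔ Avoids132 p := by
  rw [Avoids, not_iff_comm]
  constructor
  · intro h
    simp only [Avoids132, not_forall, not_not] at h
    obtain ⟨i, j, k, hij, hjk, h1, h2⟩ := h
    refine ⟨![i, j, k], ?_, ?_⟩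
    · rw [Fin.strictMono_iff_lt_succ]
      intro a
      fin_cases a <;> simpa
    · intro a b
      have h3 := h1.trans h2
      fin_cases a <;> fin_cases b <;>
        simp [pattern132, h1, h2, h3, h1.le, h2.le, h3.le]
  · rintro ⟨f, hf, h⟩ h'
    refine h' (f 0) (f 1) (f 2) (hf (by decide)) (hf (by decide)) ((h _ _).2 ?_) ((h _ _).2 ?_) <;>
      simp [pattern132]

lemma uniquePeak_unique {n x y : ℕ} {f : Fin n → Fin n} (hx : UniquePeak x f)
    (hy : UniquePeak y f) : x = y := by
  obtain ⟨i, hi, hx⟩ := hx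
  obtain ⟨j, hj, hy⟩ := hy
  by_cases h : i = j
  · subst h
    omega
  · have := hx j (Ne.symm h)
    have := hy i h
    omega

lemma topIncreasing_zero {n : ℕ} (f : Fin n → Fin n) : TopIncreasing 0 f := by
  intro i j _ h _
  omega

open Classical in
lemma iNum_eq_sum (m : ℕ) :
    iNum pattern132 (m + 1) = ∑ x ∈ Finset.Icc 1 (m + 1), (peakInvolutions (m + 1) x 0).card := by
  have hdisj : ((Finset.Icc 1 (m + 1) : Finset ℕ) : Set ℕ).PairwiseDisjoint
      fun x => peakInvolutions (m + 1) x 0 := by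
    intro x _ y _ hxy
    rw [Function.onFun, Finset.disjoint_left]
    intro f h1 h2
    exact hxy (uniquePeak_unique (mem_peakInvolutions.1 h1).2.2.1 (mem_peakInvolutions.1 h2).2.2.1)
  rw [← Finset.card_biUnion hdisj, ← Nat.card_eq_finsetCard, iNum]
  have key : ∀ p : Equiv.Perm (Fin (m + 1)), (p⁻¹ = p ∧ Avoids pattern132 p ∧ HasULIS ⇑p) ↔
      (p : Fin (m + 1) → Fin (m + 1)) ∈
        (Finset.Icc 1 (m + 1)).biUnion fun x => peakInvolutions (m + 1) x 0 := by
    intro p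
    have hinv : p⁻¹ = p ↔ Function.Involutive p := by
      constructor
      · intro h i
        nth_rewrite 1 [← h]
        simp
      · intro h
        refine Equiv.ext fun i => ?_
        rw [Equiv.Perm.inv_eq_iff_eq, h]
    simp only [Finset.mem_biUnion, mem_peakInvolutions, avoids_pattern132_iff, hinv]
    constructor
    · rintro ⟨h1, h2, h3⟩
      rw [hasULIS_iff (Nat.succ_pos m) p.injective h2] at h3
      obtain ⟨x, hx⟩ := h3
      refine ⟨x, ?_, h1, h2, hx, topIncreasing_zero _⟩
      obtain ⟨i, hi, -⟩ := hx
      have := upperRight_add_lt p i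
      rw [Finset.mem_Icc]
      omega
    · rintro ⟨x, -, h1, h2, h3, -⟩
      exact ⟨h1, h2, (hasULIS_iff (Nat.succ_pos m) p.injective h2).2 ⟨x, h3⟩⟩
  refine Nat.card_congr
    { toFun := fun p => ⟨p.1, (key p.1).1 p.2⟩
      invFun := fun f => ⟨Function.Involutive.toPerm f.1 (by
        obtain ⟨x, -, hx⟩ := Finset.mem_biUnion.1 f.2
        exact (mem_peakInvolutions.1 hx).1), (key _).2 f.2⟩
      left_inv := fun p => Subtype.ext (Equiv.ext fun _ => rfl)
      right_inv := fun f => rfl }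

/-- The number of `H ≥ 2` such that `k / H` is an odd integer. -/
def oddQuotients (k : ℕ) : ℕ := ((Finset.Icc 2 k).filter fun H => 2 * H ∣ k + H).card

lemma oddQuotients_eq {N : ℕ} {y : ℤ} (hy : y.natAbs ≤ N) :
    (oddQuotients y.natAbs : ℝ) =
      ∑ H ∈ Finset.Icc 2 N, if 2 * (H : ℤ) ∣ y - H then (1 : ℝ) else 0 := by
  have h : ∀ H : ℕ, 2 * (H : ℤ) ∣ y - H ↔ 2 * H ∣ y.natAbs + H := by
    intro H
    rw [← Int.natCast_dvd_natCast]
    push_cast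
    rcases abs_choice y with h | h
    · rw [h, ← dvd_add_self_right]; ring_nf
    · rw [h, ← dvd_neg]; ring_nf
  simp only [h, Finset.sum_boole, oddQuotients]
  congr 2
  ext H
  simp only [Finset.mem_filter, Finset.mem_Icc]
  constructor
  · rintro ⟨⟨h1, h2⟩, h3⟩
    exact ⟨⟨h1, h2.trans hy⟩, h3⟩
  · rintro ⟨⟨h1, h2⟩, h3⟩
    refine ⟨⟨h1, ?_⟩, h3⟩
    have := Nat.le_of_dvd (by omega) h3
    omega

lemma iNum_eq_walkSum (m : ℕ) : (iNum pattern132 (m + 1) : ℝ) =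
    walkSum m fun y => oddQuotients (y + 2).natAbs - oddQuotients y.natAbs := by
  have h1 : ∀ x ∈ Finset.Icc 1 (m + 1), ((peakInvolutions (m + 1) x 0).card : ℝ) =
      walkSum m (reflectedData (x + 1)) := by
    intro x hx
    simpa using card_peakInvolutions_eq_walkSum m x 0 (Finset.mem_Icc.1 hx).1
  rw [iNum_eq_sum, Nat.cast_sum, Finset.sum_congr rfl h1, ← walkSum_sum]
  refine walkSum_congr fun y hy _ => ?_
  rw [abs_le] at hy
  rw [oddQuotients_eq (N := m + 2) (by omega), oddQuotients_eq (N := m + 2) (by omega),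
    ← Finset.sum_sub_distrib]
  have h2 : Finset.Icc 2 (m + 2) = (Finset.Icc 1 (m + 1)).map (addRightEmbedding 1) :=
    (Finset.map_add_right_Icc 1 (m + 1) 1).symm
  rw [h2, Finset.sum_map]
  rfl

open Filter Topology

lemma walkSum_mono {m : ℕ} {φ ψ : ℤ → ℝ} (h : ∀ y, φ y ≤ ψ y) : walkSum m φ ≤ walkSum m ψ := by
  induction m generalizing φ ψ with
  | zero => exact h 0
  | succ m ih => exact ih fun y => add_le_add (h _) (h _)

lemma abs_walkSum_le (m : ℕ) (φ : ℤ → ℝ) : |walkSum m φ| ≤ walkSum m fun y => |φ y| := by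
  rw [abs_le, ← walkSum_neg]
  exact ⟨walkSum_mono fun y => neg_abs_le _, walkSum_mono fun y => le_abs_self _⟩

lemma walkSum_one (m : ℕ) : walkSum m (fun _ => 1) = 2 ^ m := by
  induction m with
  | zero => simp [walkSum_zero]
  | succ m ih =>
    have := walkSum_const_mul m 2 fun _ => 1
    rw [walkSum_succ, pow_succ, ← ih, mul_comm, ← this]
    norm_num

/-- Stein's identity for the simple random walk. -/
lemma walkSum_mul_self (m : ℕ) (ψ : ℤ → ℝ) : walkSum (m + 1) (fun y => y * ψ y) =
    (m + 1) * walkSum m fun y => ψ (y + 1) - ψ (y - 1) := by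
  induction m generalizing ψ with
  | zero => simp [walkSum_succ, walkSum_zero]; ring
  | succ m ih =>
    have h1 : walkSum (m + 2) (fun y => y * ψ y) =
        walkSum (m + 1) (fun y => y * (ψ (y + 1) + ψ (y - 1))) +
        walkSum (m + 1) fun y => ψ (y + 1) - ψ (y - 1) := by
      rw [walkSum_succ, ← walkSum_add]
      congr 1
      funext y
      push_cast
      ring
    rw [h1, ih fun y => ψ (y + 1) + ψ (y - 1), walkSum_succ m fun y => ψ (y + 1) - ψ (y - 1)]
    push_cast
    have h2 : (fun y : ℤ => ψ (y + 1 + 1) + ψ (y + 1 - 1) - (ψ (y - 1 + 1) + ψ (y - 1 - 1))) =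
        fun y : ℤ => ψ (y + 1 + 1) - ψ (y + 1 - 1) + (ψ (y - 1 + 1) - ψ (y - 1 - 1)) := by
      funext y
      simp only [add_sub_cancel_right, sub_add_cancel]
      ring
    rw [h2]
    ring

lemma walkSum_sq (m : ℕ) : walkSum m (fun y => (y : ℝ) ^ 2) = m * 2 ^ m := by
  rcases m with _ | m
  · simp [walkSum_zero]
  · have h := walkSum_mul_self m fun y => (y : ℝ)
    have h2 := walkSum_const_mul m 2 fun _ => 1
    have h3 : (fun y : ℤ => (((y + 1 : ℤ) : ℝ) - ((y - 1 : ℤ) : ℝ))) = fun _ => 2 * 1 := by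
      funext y
      push_cast
      ring
    rw [h3, h2, walkSum_one] at h
    simp only [← pow_two] at h
    rw [h]
    push_cast
    ring

lemma walkSum_pow_four (m : ℕ) :
    walkSum m (fun y => (y : ℝ) ^ 4) = (3 * m ^ 2 - 2 * m) * 2 ^ m := by
  rcases m with _ | m
  · simp [walkSum_zero]
  · have h := walkSum_mul_self m fun y => (y : ℝ) ^ 3
    have h3 : (fun y : ℤ => (((y + 1 : ℤ) : ℝ) ^ 3 - ((y - 1 : ℤ) : ℝ) ^ 3)) =
        fun y : ℤ => 6 * (y : ℝ) ^ 2 + 2 * 1 := by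
      funext y
      push_cast
      ring
    rw [h3, walkSum_add, walkSum_const_mul, walkSum_const_mul, walkSum_one, walkSum_sq] at h
    have h4 : (fun y : ℤ => (y : ℝ) * (y : ℝ) ^ 3) = fun y : ℤ => (y : ℝ) ^ 4 := by
      funext y
      ring
    rw [h4] at h
    rw [h]
    push_cast
    ring

lemma walkSum_third_difference (m : ℕ) (ψ : ℤ → ℝ) :
    (m + 1) * (m + 2) * (m + 3) *
      walkSum m (fun y => ψ (y + 3) - 3 * ψ (y + 1) + 3 * ψ (y - 1) - ψ (y - 3)) =
    walkSum (m + 3) fun y => (y ^ 3 - (3 * m + 7) * y) * ψ y := by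
  have e1 : (fun y : ℤ => ((y : ℝ) ^ 3 - (3 * m + 7) * y) * ψ y) =
      fun y : ℤ => (y : ℝ) * ((y : ℝ) ^ 2 * ψ y) - (3 * m + 7) * (y * ψ y) := by
    funext y
    ring
  have e2 : (fun y : ℤ => ((y + 1 : ℤ) : ℝ) ^ 2 * ψ (y + 1) - ((y - 1 : ℤ) : ℝ) ^ 2 * ψ (y - 1)) =
      fun y : ℤ => (y : ℝ) * (y * (ψ (y + 1) - ψ (y - 1)) + 2 * (ψ (y + 1) + ψ (y - 1))) +
        (ψ (y + 1) - ψ (y - 1)) := by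
    funext y
    push_cast
    ring
  have e3 : (fun y : ℤ =>
      (((y + 1 : ℤ) : ℝ) * (ψ (y + 1 + 1) - ψ (y + 1 - 1)) + 2 * (ψ (y + 1 + 1) + ψ (y + 1 - 1)))
      - (((y - 1 : ℤ) : ℝ) * (ψ (y - 1 + 1) - ψ (y - 1 - 1)) +
        2 * (ψ (y - 1 + 1) + ψ (y - 1 - 1)))) =
      fun y : ℤ => (y : ℝ) * (ψ (y + 2) - 2 * ψ y + ψ (y - 2)) +
        3 * (ψ (y + 1 + 1) - ψ (y + 1 - 1) + (ψ (y - 1 + 1) - ψ (y - 1 - 1))) := by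
    funext y
    have h1 : y + 1 + 1 = y + 2 := by ring
    have h2 : y - 1 - 1 = y - 2 := by ring
    simp only [h1, h2, add_sub_cancel_right, sub_add_cancel]
    push_cast
    ring
  have e4 : (fun y : ℤ => ψ (y + 1 + 2) - 2 * ψ (y + 1) + ψ (y + 1 - 2) -
      (ψ (y - 1 + 2) - 2 * ψ (y - 1) + ψ (y - 1 - 2))) =
      fun y : ℤ => ψ (y + 3) - 3 * ψ (y + 1) + 3 * ψ (y - 1) - ψ (y - 3) := by
    funext y
    have h1 : y + 1 + 2 = y + 3 := by ring
    have h2 : y + 1 - 2 = y - 1 := by ring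
    have h3 : y - 1 + 2 = y + 1 := by ring
    have h4 : y - 1 - 2 = y - 3 := by ring
    simp only [h1, h2, h3, h4]
    ring
  generalize hW : walkSum m (fun y => ψ (y + 3) - 3 * ψ (y + 1) + 3 * ψ (y - 1) - ψ (y - 3)) = W
  rw [e1, walkSum_sub, walkSum_const_mul, walkSum_mul_self (m + 2), walkSum_mul_self (m + 2), e2,
    walkSum_add, walkSum_mul_self (m + 1), e3, walkSum_add, walkSum_mul_self m, e4, hW,
    walkSum_const_mul, ← walkSum_succ (m + 1) (fun y : ℤ => ψ (y + 1) - ψ (y - 1))]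
  push_cast
  ring

lemma walkSum_single_zero_le (m : ℕ) :
    walkSum m (fun y => if y = 0 then 1 else 0) ≤ 2 ^ m / √(m + 1) := by
  have h := walkSum_mul_self m fun y => (Int.sign y : ℝ)
  have hM : (0 : ℝ) < √(m + 1) := by positivity
  have h1 : walkSum (m + 1) (fun y => (y : ℝ) * (Int.sign y : ℝ)) ≤ √(m + 1) * 2 ^ (m + 1) := by
    have h2 : walkSum (m + 1) (fun y => (1 / (2 * √(m + 1))) * (y : ℝ) ^ 2 + √(m + 1) / 2 * 1) =
        √(m + 1) * 2 ^ (m + 1) := by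
      rw [walkSum_add, walkSum_const_mul, walkSum_const_mul, walkSum_one, walkSum_sq]
      have : (m + 1 : ℝ) = √(m + 1) ^ 2 := (Real.sq_sqrt (by positivity)).symm
      push_cast
      field_simp
      linarith
    rw [← h2]
    refine walkSum_mono fun y => ?_
    have h3 : (y : ℝ) * (Int.sign y : ℝ) = |(y : ℝ)| := by
      have := Int.mul_sign_self y
      rw [← Int.cast_mul, this, Int.natCast_natAbs, Int.cast_abs]
    rw [h3, ← sub_nonneg, ← sq_abs (y : ℝ)]
    have : 1 / (2 * √(m + 1)) * |(y : ℝ)| ^ 2 + √(m + 1) / 2 * 1 - |(y : ℝ)| =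
        (|(y : ℝ)| - √(m + 1)) ^ 2 / (2 * √(m + 1)) := by
      field_simp
      ring
    rw [this]
    positivity
  have h4 : 2 * walkSum m (fun y => if y = 0 then 1 else 0) ≤
      walkSum m fun y => ((y + 1).sign : ℝ) - ((y - 1).sign : ℝ) := by
    rw [← walkSum_const_mul]
    refine walkSum_mono fun y => ?_
    rcases lt_trichotomy y 0 with hy | rfl | hy
    · rw [if_neg hy.ne, Int.sign_eq_neg_one_of_neg (by omega : y - 1 < 0)]
      have : -1 ≤ (y + 1).sign := by
        rcases Int.sign_trichotomy (y + 1) with h | h | h <;> rw [h] <;> norm_num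
      have : (-1 : ℝ) ≤ ((y + 1).sign : ℝ) := by exact_mod_cast this
      push_cast
      linarith
    · norm_num
    · rw [if_neg hy.ne', Int.sign_eq_one_of_pos (by omega : 0 < y + 1)]
      have : (y - 1).sign ≤ 1 := by
        rcases Int.sign_trichotomy (y - 1) with h | h | h <;> rw [h] <;> norm_num
      have : ((y - 1).sign : ℝ) ≤ 1 := by exact_mod_cast this
      push_cast
      linarith
  rw [h] at h1
  rw [le_div_iff₀ hM]
  have h5 : (m + 1 : ℝ) = √(m + 1) * √(m + 1) := (Real.mul_self_sqrt (by positivity)).symm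
  have h6 : (m + 1 : ℝ) * (2 * walkSum m (fun y => if y = 0 then 1 else 0)) ≤
      √(m + 1) * 2 ^ (m + 1) :=
    (mul_le_mul_of_nonneg_left h4 (by positivity)).trans h1
  have h7 : walkSum m (fun y => if y = 0 then 1 else 0) * √(m + 1) * 2 ≤ 2 ^ (m + 1) := by
    refine le_of_mul_le_mul_left ?_ hM
    generalize √(m + 1 : ℝ) = s at h5 h6 ⊢
    rw [h5] at h6
    linarith
  rw [pow_succ] at h7
  linarith

/-- The even function with first difference `1 / y`. -/
noncomputable def altHarmonic : ℕ → ℝ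
  | 0 => 0
  | 1 => 0
  | k + 2 => altHarmonic k + 1 / (k + 1)

lemma altHarmonic_natAbs_sub (y : ℤ) :
    (y : ℝ) * (altHarmonic (y + 1).natAbs - altHarmonic (y - 1).natAbs) =
      1 - if y = 0 then 1 else 0 := by
  rcases lt_trichotomy y 0 with hy | rfl | hy
  · obtain ⟨k, rfl⟩ : ∃ k : ℕ, y = -(k + 1) := ⟨(-y - 1).toNat, by omega⟩
    have h1 : (-((k : ℤ) + 1) + 1).natAbs = k := by omega
    have h2 : (-((k : ℤ) + 1) - 1).natAbs = k + 2 := by omega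
    rw [h1, h2, altHarmonic, if_neg hy.ne]
    push_cast
    field_simp
    ring
  · simp
  · obtain ⟨k, rfl⟩ : ∃ k : ℕ, y = k + 1 := ⟨(y - 1).toNat, by omega⟩
    have h1 : ((k : ℤ) + 1 + 1).natAbs = k + 2 := by omega
    have h2 : ((k : ℤ) + 1 - 1).natAbs = k := by omega
    rw [h1, h2, altHarmonic, if_neg hy.ne']
    push_cast
    field_simp
    ring

/-- The walk sum of the second difference of the even extension of `e`. -/
def secondDiffSum (m : ℕ) (e : ℕ → ℝ) : ℝ :=
  walkSum m fun y => e (y + 2).natAbs - 2 * e y.natAbs + e (y - 2).natAbs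

lemma secondDiffSum_altHarmonic (m : ℕ) : (m + 1) * secondDiffSum m altHarmonic =
    2 ^ (m + 1) - walkSum (m + 1) fun y => if y = 0 then 1 else 0 := by
  have h := walkSum_mul_self m fun y : ℤ =>
    altHarmonic (y + 1).natAbs - altHarmonic (y - 1).natAbs
  simp only [altHarmonic_natAbs_sub] at h
  rw [walkSum_sub, walkSum_one] at h
  rw [h, secondDiffSum]
  congr 2
  funext y
  have h1 : y + 1 + 1 = y + 2 := by ring
  have h2 : y - 1 - 1 = y - 2 := by ring
  simp only [h1, h2, add_sub_cancel_right, sub_add_cancel]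
  ring

lemma secondDiffSum_add (m : ℕ) (e e' : ℕ → ℝ) :
    secondDiffSum m (fun k => e k + e' k) = secondDiffSum m e + secondDiffSum m e' := by
  rw [secondDiffSum, secondDiffSum, secondDiffSum, ← walkSum_add]
  congr 1
  funext y
  ring

lemma secondDiffSum_mod_two (m : ℕ) (κ : ℕ → ℝ) : secondDiffSum m (fun k => κ (k % 2)) = 0 := by
  have h : ∀ y : ℤ, κ ((y + 2).natAbs % 2) - 2 * κ (y.natAbs % 2) + κ ((y - 2).natAbs % 2) =
      0 * 0 := by
    intro y
    have h1 : (y + 2).natAbs % 2 = y.natAbs % 2 := by omega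
    have h2 : (y - 2).natAbs % 2 = y.natAbs % 2 := by omega
    rw [h1, h2]
    ring
  simp only [secondDiffSum, h]
  rw [walkSum_const_mul, zero_mul]

lemma two_mul_iNum (m : ℕ) : 2 * (iNum pattern132 (m + 1) : ℝ) =
    secondDiffSum m fun k => oddQuotients k := by
  have h1 := iNum_eq_walkSum m
  have h2 := walkSum_comp_neg m fun y => (oddQuotients (y + 2).natAbs : ℝ) - oddQuotients y.natAbs
  rw [← h1] at h2
  rw [two_mul]
  nth_rewrite 1 [h1]
  rw [← h2, ← walkSum_add, secondDiffSum]
  congr 1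
  funext y
  have h3 : (-y + 2).natAbs = (y - 2).natAbs := by omega
  rw [h3, Int.natAbs_neg]
  ring

/-- Partial sums of `e` along the residue classes modulo `2`. -/
noncomputable def stepSum (e : ℕ → ℝ) : ℕ → ℝ
  | 0 => 0
  | 1 => e 0 / 2
  | k + 2 => stepSum e k + e (k + 1)

lemma stepSum_diff (e : ℕ → ℝ) (y : ℤ) :
    (y + 1).sign * stepSum e (y + 1).natAbs - (y - 1).sign * stepSum e (y - 1).natAbs =
      e y.natAbs := by
  have key : ∀ y : ℤ, 0 ≤ y → (y.sign : ℝ) * stepSum e y.natAbs = stepSum e y.natAbs := by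
    intro y hy
    rcases hy.eq_or_lt with rfl | hy
    · simp [stepSum]
    · simp [Int.sign_eq_one_of_pos hy]
  have key' : ∀ y : ℤ, y ≤ 0 → (y.sign : ℝ) * stepSum e y.natAbs = -stepSum e y.natAbs := by
    intro y hy
    rcases hy.eq_or_lt with rfl | hy
    · simp [stepSum]
    · simp [Int.sign_eq_neg_one_of_neg hy]
  rcases lt_trichotomy y 0 with hy | rfl | hy
  · rw [key' _ (by omega), key' _ (by omega)]
    obtain ⟨k, rfl⟩ : ∃ k : ℕ, y = -(k + 1) := ⟨(-y - 1).toNat, by omega⟩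
    have h1 : (-((k : ℤ) + 1) + 1).natAbs = k := by omega
    have h2 : (-((k : ℤ) + 1) - 1).natAbs = k + 2 := by omega
    have h3 : (-((k : ℤ) + 1)).natAbs = k + 1 := by omega
    rw [h1, h2, h3, stepSum]
    ring
  · norm_num [stepSum]
  · rw [key _ (by omega), key _ (by omega)]
    obtain ⟨k, rfl⟩ : ∃ k : ℕ, y = k + 1 := ⟨(y - 1).toNat, by omega⟩
    have h1 : ((k : ℤ) + 1 + 1).natAbs = k + 2 := by omega
    have h2 : ((k : ℤ) + 1 - 1).natAbs = k := by omega
    have h3 : ((k : ℤ) + 1).natAbs = k + 1 := by omega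
    rw [h1, h2, h3, stepSum]
    ring

lemma secondDiffSum_bound (e : ℕ → ℝ) {η C : ℝ} (hη : 0 < η)
    (h : ∀ k, |stepSum e k| ≤ η * k + C) (m : ℕ) :
    |(m + 1) * secondDiffSum m e / 2 ^ m| ≤ 192 * η + 32 * (C ^ 2 / η) / (m + 2) := by
  set ψ : ℤ → ℝ := fun y => y.sign * stepSum e y.natAbs with hψ
  have hC : 0 ≤ C := by simpa [stepSum] using h 0
  have e1 : secondDiffSum m e =
      walkSum m (fun y => ψ (y + 3) - 3 * ψ (y + 1) + 3 * ψ (y - 1) - ψ (y - 3)) := by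
    rw [secondDiffSum]
    congr 1
    funext y
    rw [← stepSum_diff e (y + 2), ← stepSum_diff e y, ← stepSum_diff e (y - 2)]
    have h1 : y + 2 + 1 = y + 3 := by ring
    have h2 : y + 2 - 1 = y + 1 := by ring
    have h3 : y - 2 + 1 = y - 1 := by ring
    have h4 : y - 2 - 1 = y - 3 := by ring
    simp only [h1, h2, h3, h4, hψ]
    ring
  have e2 := walkSum_third_difference m ψ
  rw [← e1] at e2
  have hψb : ∀ y, |ψ y| ≤ η * |(y : ℝ)| + C := by
    intro y
    have h1 : |(y.sign : ℝ)| ≤ 1 := by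
      rcases Int.sign_trichotomy y with h | h | h <;> rw [h] <;> norm_num
    have h2 := h y.natAbs
    rw [Nat.cast_natAbs, Int.cast_abs] at h2
    rw [hψ, abs_mul]
    calc _ ≤ 1 * |stepSum e y.natAbs| := by gcongr
      _ ≤ _ := by rwa [one_mul]
  set M : ℝ := m + 3 with hM
  have hm0 : (0 : ℝ) ≤ m := Nat.cast_nonneg m
  have e3 : |(m + 1) * (m + 2) * (m + 3) * secondDiffSum m e| ≤
      (12 * η * M ^ 2 + 4 * (C ^ 2 / η) * M) * 2 ^ (m + 3) := by
    rw [e2]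
    refine (abs_walkSum_le _ _).trans ?_
    have e4 : walkSum (m + 3) (fun y => 2 * η * (y : ℝ) ^ 4 +
        ((6 * M * η + C ^ 2 / η) * (y : ℝ) ^ 2 + 3 * M * (C ^ 2 / η) * 1)) ≤
        (12 * η * M ^ 2 + 4 * (C ^ 2 / η) * M) * 2 ^ (m + 3) := by
      simp only [walkSum_add, walkSum_const_mul, walkSum_one, walkSum_sq, walkSum_pow_four]
      push_cast
      rw [← hM]
      have : 0 ≤ η * M * 2 ^ (m + 3) := by positivity
      nlinarith
    refine le_trans (walkSum_mono fun y => ?_) e4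
    have h1 : |(y : ℝ) ^ 3 - (3 * m + 7) * y| ≤ |(y : ℝ)| * ((y : ℝ) ^ 2 + 3 * M) := by
      have : (y : ℝ) ^ 3 - (3 * m + 7) * y = y * (y ^ 2 - (3 * m + 7)) := by ring
      rw [this, abs_mul]
      gcongr
      rw [abs_le]
      constructor <;> nlinarith [sq_nonneg (y : ℝ)]
    rw [abs_mul]
    calc _ ≤ |(y : ℝ)| * ((y : ℝ) ^ 2 + 3 * M) * (η * |(y : ℝ)| + C) := by
          gcongr
          exact hψb y
      _ = ((y : ℝ) ^ 2 + 3 * M) * (η * |(y : ℝ)| ^ 2 + C * |(y : ℝ)|) := by ring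
      _ ≤ ((y : ℝ) ^ 2 + 3 * M) * (2 * η * |(y : ℝ)| ^ 2 + C ^ 2 / η) := by
          refine mul_le_mul_of_nonneg_left ?_ (by positivity)
          have : 2 * η * |(y : ℝ)| ^ 2 + C ^ 2 / η - (η * |(y : ℝ)| ^ 2 + C * |(y : ℝ)|) =
              ((η * |(y : ℝ)| - C / 2) ^ 2 + 3 / 4 * C ^ 2) / η := by
            field_simp
            ring
          have h2 : 0 ≤ ((η * |(y : ℝ)| - C / 2) ^ 2 + 3 / 4 * C ^ 2) / η := by positivity
          linarith
      _ = _ := by rw [sq_abs]; ring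
  have e5 : |(m + 1) * secondDiffSum m e / 2 ^ m| =
      |(m + 1) * (m + 2) * (m + 3) * secondDiffSum m e| / ((m + 2) * M * 2 ^ m) := by
    rw [← abs_of_pos (by positivity : 0 < (m + 2 : ℝ) * M * 2 ^ m), ← abs_div]
    congr 1
    rw [hM]
    field_simp
  rw [e5, div_le_iff₀ (by positivity)]
  refine e3.trans ?_
  have e6 : (192 * η + 32 * (C ^ 2 / η) / (m + 2)) * ((m + 2) * M * 2 ^ m) =
      (192 * η * (m + 2) * M + 32 * (C ^ 2 / η) * M) * 2 ^ m := by
    field_simp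
  rw [e6, pow_add, mul_comm ((2 : ℝ) ^ m), ← mul_assoc]
  refine mul_le_mul_of_nonneg_right ?_ (by positivity)
  have e7 : 0 ≤ η * M * (m + 1) := by positivity
  nlinarith

/-- The sum of `s a * t b` over the positive lattice points under the hyperbola `a * b = n`. -/
noncomputable def hyperbolaSum (s t : ℕ → ℝ) (n : ℕ) : ℝ :=
  ∑ a ∈ Finset.Icc 1 n, ∑ b ∈ Finset.Icc 1 n, if a * b ≤ n then s a * t b else 0

lemma sum_Icc_ite_le (f : ℕ → ℝ) {J n : ℕ} (h : J ≤ n) :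
    ∑ a ∈ Finset.Icc 1 n, (if a ≤ J then f a else 0) = ∑ a ∈ Finset.Icc 1 J, f a := by
  rw [← Finset.sum_filter]
  congr 1
  ext a
  simp only [Finset.mem_filter, Finset.mem_Icc]
  omega

lemma sum_Icc_ite_mul_le (f : ℕ → ℝ) {a : ℕ} (n : ℕ) (ha : 1 ≤ a) :
    ∑ b ∈ Finset.Icc 1 n, (if a * b ≤ n then f b else 0) = ∑ b ∈ Finset.Icc 1 (n / a), f b := by
  rw [← sum_Icc_ite_le f (Nat.div_le_self n a)]
  refine Finset.sum_congr rfl fun b _ => ?_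
  simp only [Nat.le_div_iff_mul_le ha, mul_comm b a]

lemma hyperbolaSum_eq (s t : ℕ → ℝ) (n : ℕ) : hyperbolaSum s t n =
    ∑ a ∈ Finset.Icc 1 n.sqrt, s a * ∑ b ∈ Finset.Icc 1 (n / a), t b +
    ∑ b ∈ Finset.Icc 1 n.sqrt, t b * ∑ a ∈ Finset.Icc 1 (n / b), s a -
    (∑ a ∈ Finset.Icc 1 n.sqrt, s a) * ∑ b ∈ Finset.Icc 1 n.sqrt, t b := by
  have hJ := Nat.sqrt_le_self n
  have hpt : ∀ a b : ℕ, (if a * b ≤ n then s a * t b else 0) =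
      (if a ≤ n.sqrt then if a * b ≤ n then s a * t b else 0 else 0) +
      (if b ≤ n.sqrt then if b * a ≤ n then t b * s a else 0 else 0) -
      if a ≤ n.sqrt then if b ≤ n.sqrt then s a * t b else 0 else 0 := by
    intro a b
    rw [mul_comm b a, mul_comm (t b)]
    have h1 := Nat.sqrt_le' n
    have h2 := Nat.lt_succ_sqrt' n
    by_cases ha : a ≤ n.sqrt <;> by_cases hb : b ≤ n.sqrt
    · have : a * b ≤ n := by nlinarith
      simp [ha, hb, this]
    · simp [ha, hb]
    · simp [ha, hb]
    · have : ¬ a * b ≤ n := by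
        rw [Nat.succ_eq_add_one] at h2
        push Not at *
        nlinarith
      simp [ha, hb, this]
  have key : ∀ s t : ℕ → ℝ, ∑ a ∈ Finset.Icc 1 n, ∑ b ∈ Finset.Icc 1 n,
      (if a ≤ n.sqrt then if a * b ≤ n then s a * t b else 0 else 0) =
      ∑ a ∈ Finset.Icc 1 n.sqrt, s a * ∑ b ∈ Finset.Icc 1 (n / a), t b := by
    intro s t
    rw [← sum_Icc_ite_le _ hJ]
    refine Finset.sum_congr rfl fun a ha => ?_
    split_ifs
    · rw [sum_Icc_ite_mul_le _ n (Finset.mem_Icc.1 ha).1, Finset.mul_sum]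
    · simp
  unfold hyperbolaSum
  rw [Finset.sum_congr rfl fun a _ => Finset.sum_congr rfl fun b _ => hpt a b]
  simp only [Finset.sum_add_distrib, Finset.sum_sub_distrib]
  rw [key s t]
  congr 2
  · rw [Finset.sum_comm]
    exact key t s
  · rw [← sum_Icc_ite_le _ hJ, Finset.sum_mul]
    refine Finset.sum_congr rfl fun a ha => ?_
    split_ifs
    · rw [sum_Icc_ite_le _ hJ, Finset.mul_sum]
    · simp

lemma abs_sum_mul_sum_sub_le {s t : ℕ → ℝ} (hs : ∀ a, |s a| ≤ 1)
    (ht : ∀ n : ℕ, |∑ b ∈ Finset.Icc 1 n, t b - n / 2| ≤ 1) (n J : ℕ) :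
    |∑ a ∈ Finset.Icc 1 J, s a * ∑ b ∈ Finset.Icc 1 (n / a), t b -
      n / 2 * ∑ a ∈ Finset.Icc 1 J, s a / a| ≤ 3 / 2 * J := by
  rw [Finset.mul_sum, ← Finset.sum_sub_distrib]
  refine (Finset.abs_sum_le_sum_abs _ _).trans ?_
  have : ∀ a ∈ Finset.Icc 1 J, |s a * ∑ b ∈ Finset.Icc 1 (n / a), t b - n / 2 * (s a / a)| ≤
      3 / 2 := by
    intro a ha
    have ha1 : (1 : ℝ) ≤ a := by exact_mod_cast (Finset.mem_Icc.1 ha).1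
    have h1 := ht (n / a)
    have h2 : ((n / a : ℕ) : ℝ) ≤ n / a := Nat.cast_div_le
    have h3 : (n / a : ℝ) ≤ (n / a : ℕ) + 1 := by
      rw [div_le_iff₀ (by linarith)]
      have h4 := Nat.lt_div_mul_add (a := n) (show 0 < a from (Finset.mem_Icc.1 ha).1)
      have h5 : (n : ℝ) ≤ (n / a : ℕ) * a + a := by exact_mod_cast h4.le
      linarith
    have h4 : s a * ∑ b ∈ Finset.Icc 1 (n / a), t b - n / 2 * (s a / a) =
        s a * (∑ b ∈ Finset.Icc 1 (n / a), t b - (n / a) / 2) := by ring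
    rw [h4, abs_mul]
    refine (mul_le_of_le_one_left (abs_nonneg _) (hs a)).trans ?_
    rw [abs_le] at h1 ⊢
    constructor <;> linarith
  refine (Finset.sum_le_sum this).trans ?_
  simp [mul_comm]

lemma tendsto_nat_sqrt : Tendsto Nat.sqrt atTop atTop :=
  tendsto_atTop.2 fun b => by
    filter_upwards [eventually_ge_atTop (b * b)] with n hn
    exact Nat.le_sqrt.2 hn

lemma tendsto_nat_sqrt_div : Tendsto (fun n : ℕ => (n.sqrt : ℝ) / n) atTop (𝓝 0) := by
  refine squeeze_zero' (Eventually.of_forall fun n => by positivity) ?_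
    ((tendsto_inv_atTop_zero.comp tendsto_natCast_atTop_atTop).comp tendsto_nat_sqrt)
  filter_upwards [eventually_gt_atTop 0] with n hn
  have h1 : (0 : ℝ) < n.sqrt := by exact_mod_cast Nat.sqrt_pos.2 hn
  have h2 : (n.sqrt : ℝ) * n.sqrt ≤ n := by exact_mod_cast Nat.sqrt_le n
  simp only [Function.comp_apply]
  rw [div_le_iff₀ (by positivity), inv_mul_eq_div, le_div_iff₀ h1]
  exact h2

lemma tendsto_nat_sqrt_sq_div : Tendsto (fun n : ℕ => (n.sqrt : ℝ) ^ 2 / n) atTop (𝓝 1) := by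
  have h := (tendsto_nat_sqrt_div.const_mul 2).const_sub 1
  rw [mul_zero, sub_zero] at h
  refine tendsto_of_tendsto_of_tendsto_of_le_of_le' h tendsto_const_nhds ?_ ?_
  · filter_upwards [eventually_gt_atTop 0] with n hn
    have h2 : (n : ℝ) ≤ n.sqrt * n.sqrt + n.sqrt + n.sqrt := by exact_mod_cast Nat.sqrt_le_add n
    have : (0 : ℝ) < n := by exact_mod_cast hn
    rw [le_div_iff₀ this]
    field_simp
    linarith
  · filter_upwards [eventually_gt_atTop 0] with n hn
    have h2 : (n.sqrt : ℝ) * n.sqrt ≤ n := by exact_mod_cast Nat.sqrt_le n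
    have : (0 : ℝ) < n := by exact_mod_cast hn
    rw [div_le_one this]
    linarith

/-- Dirichlet's hyperbola method for two weights of density `1 / 2`. -/
lemma tendsto_hyperbolaSum {s t : ℕ → ℝ} {cs ct : ℝ} (hs : ∀ a, |s a| ≤ 1) (ht : ∀ a, |t a| ≤ 1)
    (hs1 : ∀ n : ℕ, |∑ a ∈ Finset.Icc 1 n, s a - n / 2| ≤ 1)
    (ht1 : ∀ n : ℕ, |∑ a ∈ Finset.Icc 1 n, t a - n / 2| ≤ 1)
    (hs2 : Tendsto (fun n : ℕ => ∑ a ∈ Finset.Icc 1 n, s a / a - 1 / 2 * Real.log n)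
      atTop (𝓝 cs))
    (ht2 : Tendsto (fun n : ℕ => ∑ a ∈ Finset.Icc 1 n, t a / a - 1 / 2 * Real.log n)
      atTop (𝓝 ct)) :
    Tendsto (fun n : ℕ => hyperbolaSum s t n / n - 1 / 4 * Real.log n) atTop
      (𝓝 ((cs + ct) / 2 - 1 / 4)) := by
  have hlog : Tendsto (fun n : ℕ => 1 / 4 * Real.log ((n.sqrt : ℝ) ^ 2 / n)) atTop (𝓝 0) := by
    have := (tendsto_nat_sqrt_sq_div.log one_ne_zero).const_mul (1 / 4)
    simpa using this
  have hmain := ((((hs2.comp tendsto_nat_sqrt).add (ht2.comp tendsto_nat_sqrt)).div_const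
    2).sub_const (1 / 4)).add hlog
  rw [add_zero] at hmain
  have herr : Tendsto (fun n : ℕ => 5 * ((n.sqrt : ℝ) / n)) atTop (𝓝 0) := by
    simpa using tendsto_nat_sqrt_div.const_mul 5
  refine tendsto_of_tendsto_of_dist hmain (squeeze_zero' (Eventually.of_forall fun _ =>
    dist_nonneg) ?_ herr)
  filter_upwards [eventually_gt_atTop 0] with n hn
  have hn0 : (0 : ℝ) < n := by exact_mod_cast hn
  have hJ0 : (0 : ℝ) < n.sqrt := by exact_mod_cast Nat.sqrt_pos.2 hn
  have hJ1 : (n.sqrt : ℝ) * n.sqrt ≤ n := by exact_mod_cast Nat.sqrt_le n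
  have hJ2 : (n : ℝ) ≤ n.sqrt * n.sqrt + n.sqrt + n.sqrt := by exact_mod_cast Nat.sqrt_le_add n
  have b1 := abs_sum_mul_sum_sub_le hs ht1 n n.sqrt
  have b2 := abs_sum_mul_sum_sub_le ht hs1 n n.sqrt
  have b3 := hs1 n.sqrt
  have b4 := ht1 n.sqrt
  have b5 : |∑ a ∈ Finset.Icc 1 n.sqrt, s a| ≤ n.sqrt := by
    refine (Finset.abs_sum_le_sum_abs _ _).trans ((Finset.sum_le_sum fun a _ => hs a).trans ?_)
    simp
  rw [dist_comm, Real.dist_eq]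
  simp only [Function.comp_apply]
  rw [Real.log_div (by positivity) (by positivity), Real.log_pow, hyperbolaSum_eq]
  generalize hX : ∑ a ∈ Finset.Icc 1 n.sqrt, s a * ∑ b ∈ Finset.Icc 1 (n / a), t b = X at *
  generalize hY : ∑ b ∈ Finset.Icc 1 n.sqrt, t b * ∑ a ∈ Finset.Icc 1 (n / b), s a = Y at *
  generalize ∑ a ∈ Finset.Icc 1 n.sqrt, s a = A at *
  generalize ∑ a ∈ Finset.Icc 1 n.sqrt, t a = B at *
  generalize ∑ a ∈ Finset.Icc 1 n.sqrt, s a / a = hS at *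
  generalize ∑ a ∈ Finset.Icc 1 n.sqrt, t a / a = hT at *
  generalize (n.sqrt : ℝ) = J at *
  have e1 : (X + Y - A * B) / n - 1 / 4 * Real.log n -
      ((hS - 1 / 2 * Real.log J + (hT - 1 / 2 * Real.log J)) / 2 - 1 / 4 +
        1 / 4 * ((2 : ℕ) * Real.log J - Real.log n)) =
      ((X - n / 2 * hS) + (Y - n / 2 * hT) - (A * (B - J / 2) + J / 2 * (A - J / 2)) +
        (n - J * J) / 4) / n := by
    push_cast
    field_simp
    ring
  rw [e1, abs_div, abs_of_pos hn0, ← mul_div_assoc, div_le_div_iff_of_pos_right hn0]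
  have b6 : |A * (B - J / 2)| ≤ J * 1 := by
    rw [abs_mul]
    gcongr
  have b7 : |J / 2 * (A - J / 2)| ≤ J / 2 * 1 := by
    rw [abs_mul, abs_of_pos (by positivity : 0 < J / 2)]
    gcongr
  rw [abs_le] at *
  constructor <;> linarith

/-- The indicator of the residue class `r` modulo `2`. -/
noncomputable def parityIndicator (r a : ℕ) : ℝ := if a % 2 = r then 1 else 0

lemma abs_parityIndicator_le (r a : ℕ) : |parityIndicator r a| ≤ 1 := by
  unfold parityIndicator
  split_ifs <;> simp

lemma parityIndicator_one (a : ℕ) : parityIndicator 1 a = 1 - parityIndicator 0 a := by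
  unfold parityIndicator
  rcases Nat.mod_two_eq_zero_or_one a with h | h <;> simp [h]

lemma sum_parityIndicator_zero (n : ℕ) :
    ∑ a ∈ Finset.Icc 1 n, parityIndicator 0 a = (n / 2 : ℕ) := by
  induction n with
  | zero => simp
  | succ n ih =>
    rw [Finset.sum_Icc_succ_top (by omega), ih, parityIndicator]
    split_ifs with h
    · have : (n + 1) / 2 = n / 2 + 1 := by omega
      rw [this]
      push_cast
      ring
    · have : (n + 1) / 2 = n / 2 := by omega
      rw [this, add_zero]

lemma abs_sum_parityIndicator_sub_le {r : ℕ} (hr : r < 2) (n : ℕ) :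
    |∑ a ∈ Finset.Icc 1 n, parityIndicator r a - n / 2| ≤ 1 := by
  have h1 : ((2 * (n / 2) : ℕ) : ℝ) ≤ n := by exact_mod_cast Nat.mul_div_le n 2
  have h2 : (n : ℝ) ≤ ((2 * (n / 2) + 1 : ℕ) : ℝ) := by
    have : n ≤ 2 * (n / 2) + 1 := by omega
    exact_mod_cast this
  push_cast at h1 h2
  rw [abs_le]
  interval_cases r
  · rw [sum_parityIndicator_zero]
    constructor <;> linarith
  · simp only [parityIndicator_one, Finset.sum_sub_distrib, sum_parityIndicator_zero]
    simp only [Finset.sum_const, Nat.card_Icc, add_tsub_cancel_right, nsmul_eq_mul, mul_one]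
    constructor <;> linarith

lemma sum_parityIndicator_zero_div (n : ℕ) :
    ∑ a ∈ Finset.Icc 1 n, parityIndicator 0 a / a = 1 / 2 * (harmonic (n / 2) : ℝ) := by
  induction n with
  | zero => simp
  | succ n ih =>
    rw [Finset.sum_Icc_succ_top (by omega), ih, parityIndicator]
    split_ifs with h
    · have h1 : (n + 1) / 2 = n / 2 + 1 := by omega
      have h2 : n + 1 = 2 * (n / 2 + 1) := by omega
      have h3 : ((n + 1 : ℕ) : ℝ) = 2 * ((n / 2 : ℕ) + 1) := by exact_mod_cast h2
      rw [h1, harmonic_succ, h3]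
      push_cast
      field_simp
    · have : (n + 1) / 2 = n / 2 := by omega
      rw [this, zero_div, add_zero]

lemma tendsto_nat_div_two : Tendsto (fun n : ℕ => n / 2) atTop atTop :=
  tendsto_atTop.2 fun b => by
    filter_upwards [eventually_ge_atTop (2 * b)] with n hn
    omega

lemma tendsto_log_nat_div_two :
    Tendsto (fun n : ℕ => Real.log (n / 2 : ℕ) - Real.log n) atTop (𝓝 (Real.log (1 / 2))) := by
  have h : Tendsto (fun n : ℕ => ((n / 2 : ℕ) : ℝ) / n) atTop (𝓝 (1 / 2)) := by
    have h := (tendsto_one_div_atTop_nhds_zero_nat (𝕜 := ℝ)).const_sub (1 / 2)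
    rw [sub_zero] at h
    refine tendsto_of_tendsto_of_tendsto_of_le_of_le' h tendsto_const_nhds ?_ ?_
    all_goals
      filter_upwards [eventually_gt_atTop 0] with n hn
      have h1 : ((2 * (n / 2) : ℕ) : ℝ) ≤ n := by exact_mod_cast Nat.mul_div_le n 2
      have h2 : (n : ℝ) ≤ ((2 * (n / 2) + 1 : ℕ) : ℝ) := by
        have : n ≤ 2 * (n / 2) + 1 := by omega
        exact_mod_cast this
      push_cast at h1 h2
      have : (0 : ℝ) < n := by exact_mod_cast hn
    · rw [le_div_iff₀ this]
      field_simp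
      linarith
    · rw [div_le_iff₀ this]
      linarith
  refine (h.log (by norm_num)).congr' ?_
  filter_upwards [eventually_ge_atTop 2] with n hn
  have h1 : n / 2 ≠ 0 := by omega
  have h2 : n ≠ 0 := by omega
  rw [Real.log_div (by exact_mod_cast h1) (by exact_mod_cast h2)]

lemma exists_tendsto_sum_parityIndicator_div :
    ∃ c : ℕ → ℝ, ∀ r < 2, Tendsto (fun n : ℕ => ∑ a ∈ Finset.Icc 1 n, parityIndicator r a / a -
      1 / 2 * Real.log n) atTop (𝓝 (c r)) := by
  have hγ := Real.tendsto_harmonic_sub_log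
  have h0 : Tendsto (fun n : ℕ => ∑ a ∈ Finset.Icc 1 n, parityIndicator 0 a / a -
      1 / 2 * Real.log n) atTop
      (𝓝 (1 / 2 * (Real.eulerMascheroniConstant + Real.log (1 / 2)))) := by
    refine (((hγ.comp tendsto_nat_div_two).add tendsto_log_nat_div_two).const_mul
      (1 / 2)).congr fun n => ?_
    rw [sum_parityIndicator_zero_div, Function.comp_apply]
    ring
  refine ⟨fun r => if r = 0 then 1 / 2 * (Real.eulerMascheroniConstant + Real.log (1 / 2)) else
    Real.eulerMascheroniConstant -
      1 / 2 * (Real.eulerMascheroniConstant + Real.log (1 / 2)), fun r hr => ?_⟩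
  interval_cases r
  · exact h0
  · refine (hγ.sub h0).congr fun n => ?_
    simp only [parityIndicator_one, sub_div, Finset.sum_sub_distrib]
    rw [harmonic_eq_sum_Icc]
    push_cast
    simp only [one_div]
    ring

lemma altHarmonic_succ (k : ℕ) :
    altHarmonic (k + 1) = ∑ a ∈ Finset.Icc 1 k, parityIndicator (k % 2) a / a := by
  induction k using Nat.twoStepInduction with
  | zero => simp [altHarmonic]
  | one => simp [altHarmonic, parityIndicator]
  | more k ih _ =>
    rw [altHarmonic, ih, Finset.sum_Icc_succ_top (by omega), Finset.sum_Icc_succ_top (by omega)]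
    have h1 : (k + 2) % 2 = k % 2 := by omega
    have h2 : ¬ (k + 1) % 2 = k % 2 := by omega
    have h3 : (k + 1 + 1) % 2 = k % 2 := by omega
    rw [h1, parityIndicator.eq_1 _ (k + 1), parityIndicator.eq_1 _ (k + 1 + 1), if_neg h2,
      if_pos h3]
    push_cast
    ring

lemma stepSum_altHarmonic (k : ℕ) : stepSum altHarmonic k =
    k / 2 * altHarmonic (k + 1) - k / 4 - (k % 2 : ℕ) / 4 := by
  induction k using Nat.twoStepInduction with
  | zero => simp [stepSum]
  | one =>
    norm_num [stepSum, altHarmonic]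
  | more k ih _ =>
    have h1 : (k + 2) % 2 = k % 2 := by omega
    rw [stepSum, ih, h1, altHarmonic.eq_3 (k + 1)]
    push_cast
    field_simp
    ring

lemma stepSum_mod_two (κ : ℕ → ℝ) (k : ℕ) :
    stepSum (fun k => κ (k % 2)) k = k / 2 * κ ((k + 1) % 2) := by
  induction k using Nat.twoStepInduction with
  | zero => simp [stepSum]
  | one => simp [stepSum]; ring
  | more k ih _ =>
    have h1 : (k + 2 + 1) % 2 = (k + 1) % 2 := by omega
    rw [stepSum, ih, h1]
    push_cast
    ring

lemma stepSum_sub (e f : ℕ → ℝ) (k : ℕ) :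
    stepSum (fun k => e k - f k) k = stepSum e k - stepSum f k := by
  induction k using Nat.twoStepInduction with
  | zero => simp [stepSum]
  | one => simp [stepSum]; ring
  | more k ih _ =>
    simp only [stepSum, ih]
    ring

lemma oddQuotients_add_mod_two {k N : ℕ} (hk : 1 ≤ k) (hN : k ≤ N) :
    (oddQuotients k : ℝ) + (k % 2 : ℕ) =
      ∑ a ∈ Finset.Icc 1 N, ∑ b ∈ Finset.Icc 1 N, if a * b = k ∧ a % 2 = 1 then 1 else 0 := by
  have h1 : oddQuotients k + k % 2 =
      ((Finset.Icc 1 k).filter fun H => 2 * H ∣ k + H).card := by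
    have : Finset.Icc 1 k = insert 1 (Finset.Icc 2 k) := by
      ext H
      simp only [Finset.mem_Icc, Finset.mem_insert]
      omega
    rw [this, Finset.filter_insert, oddQuotients]
    split_ifs with h
    · rw [Finset.card_insert_of_notMem (by simp)]
      omega
    · omega
  have h2 : ((Finset.Icc 1 k).filter fun H => 2 * H ∣ k + H).card =
      ((Finset.Icc 1 N ×ˢ Finset.Icc 1 N).filter fun x => x.1 * x.2 = k ∧ x.1 % 2 = 1).card := by
    refine Finset.card_nbij' (fun H => (k / H, H)) Prod.snd ?_ ?_ ?_ ?_
    · intro H hH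
      simp only [Finset.coe_filter, Finset.mem_Icc, Set.mem_ofPred_eq, Finset.mem_product] at hH ⊢
      obtain ⟨⟨hH1, hHk⟩, c, hc⟩ := hH
      obtain ⟨d, rfl⟩ : ∃ d, c = d + 1 := ⟨c - 1, by
        rcases c with _ | c
        · omega
        · omega⟩
      have hk2 : k = H * (2 * d + 1) := by nlinarith
      have hdiv : k / H = 2 * d + 1 := by
        rw [hk2]
        exact Nat.mul_div_cancel_left _ (by omega)
      have hle : k / H ≤ k := Nat.div_le_self k H
      rw [hdiv] at hle ⊢
      refine ⟨⟨⟨by omega, by omega⟩, by omega, by omega⟩, ?_, by omega⟩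
      rw [hk2, mul_comm]
    · rintro ⟨a, b⟩ h
      simp only [Finset.coe_filter, Finset.mem_Icc, Set.mem_ofPred_eq, Finset.mem_product] at h ⊢
      obtain ⟨⟨⟨ha, -⟩, hb, -⟩, hab, hodd⟩ := h
      refine ⟨⟨hb, hab ▸ Nat.le_mul_of_pos_left b ha⟩, (a + 1) / 2, ?_⟩
      have : 2 * ((a + 1) / 2) = a + 1 := by omega
      calc k + b = (a + 1) * b := by rw [← hab]; ring
        _ = 2 * ((a + 1) / 2) * b := by rw [this]
        _ = _ := by ring
    · intro H _
      rfl
    · rintro ⟨a, b⟩ h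
      simp only [Finset.coe_filter, Finset.mem_Icc, Set.mem_ofPred_eq, Finset.mem_product] at h
      obtain ⟨⟨-, hb, -⟩, hab, -⟩ := h
      simp only [Prod.mk.injEq, and_true]
      rw [← hab]
      exact Nat.mul_div_cancel _ hb
  rw [← Finset.sum_product', Finset.sum_boole, ← h2, ← h1]
  push_cast
  ring

lemma stepSum_oddQuotients (k : ℕ) : stepSum (fun k => oddQuotients k) k +
    ((k + 1) % 2 : ℕ) * (k / 2) =
      hyperbolaSum (parityIndicator 1) (parityIndicator ((k + 1) % 2)) k := by
  suffices ∀ N, k ≤ N → stepSum (fun k => oddQuotients k) k +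
      ((k + 1) % 2 : ℕ) * (k / 2) = ∑ a ∈ Finset.Icc 1 N, ∑ b ∈ Finset.Icc 1 N,
      if a * b ≤ k then parityIndicator 1 a * parityIndicator ((k + 1) % 2) b else 0 from
    this k le_rfl
  intro N
  induction k using Nat.twoStepInduction with
  | zero =>
    intro _
    rw [Finset.sum_eq_zero fun a ha => Finset.sum_eq_zero fun b hb => ?_]
    · simp [stepSum]
    · have := Nat.mul_pos (Finset.mem_Icc.1 ha).1 (Finset.mem_Icc.1 hb).1
      rw [if_neg (by omega)]
  | one =>
    intro _
    rw [Finset.sum_eq_zero fun a ha => Finset.sum_eq_zero fun b hb => ?_]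
    · simp [stepSum, oddQuotients]
    · have h1 := (Finset.mem_Icc.1 ha).1
      have h2 := (Finset.mem_Icc.1 hb).1
      split_ifs with h
      · have : b = 1 := by nlinarith
        simp [this, parityIndicator]
      · rfl
  | more k ih _ =>
    intro hN
    have h1 : (k + 2 + 1) % 2 = (k + 1) % 2 := by omega
    have h2 := oddQuotients_add_mod_two (k := k + 1) (N := N) (by omega) (by omega)
    have h3 : ∀ a b : ℕ, (if a * b ≤ k + 2 then
        parityIndicator 1 a * parityIndicator ((k + 1) % 2) b else 0) =
        (if a * b ≤ k then parityIndicator 1 a * parityIndicator ((k + 1) % 2) b else 0) +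
        if a * b = k + 1 ∧ a % 2 = 1 then 1 else 0 := by
      intro a b
      unfold parityIndicator
      by_cases ha : a % 2 = 1
      · have hab : a * b % 2 = b % 2 := by rw [Nat.mul_mod, ha, one_mul, Nat.mod_mod]
        generalize a * b = x at hab ⊢
        by_cases hb : b % 2 = (k + 1) % 2
        · simp only [ha, hb, and_true, if_true, one_mul]
          by_cases hx : x ≤ k
          · rw [if_pos (by omega), if_pos hx, if_neg (by omega), add_zero]
          · by_cases hx2 : x = k + 1
            · rw [if_pos (by omega), if_neg hx, if_pos hx2, zero_add]
            · rw [if_neg (by omega), if_neg hx, if_neg hx2, zero_add]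
        · have : x ≠ k + 1 := by omega
          simp [hb, this]
      · simp [ha]
    simp only [h1, h3, Finset.sum_add_distrib]
    rw [← ih (by omega), ← h2, stepSum]
    push_cast
    ring

lemma exists_stepSum_sub_isLittleO : ∃ κ : ℕ → ℝ, Tendsto (fun k : ℕ => stepSum (fun k =>
    oddQuotients k - altHarmonic k - κ (k % 2)) k / k) atTop (𝓝 0) := by
  obtain ⟨c, hc⟩ := exists_tendsto_sum_parityIndicator_div
  set τ : ℕ → ℝ := fun r => (c 1 + c r) / 2 - 1 / 4 with hτ
  have hT : ∀ r < 2, Tendsto (fun n : ℕ => |hyperbolaSum (parityIndicator 1) (parityIndicator r) n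
      / n - 1 / 4 * Real.log n - τ r|) atTop (𝓝 0) := fun r hr =>
    tendsto_zero_iff_abs_tendsto_zero _ |>.1 <| tendsto_sub_nhds_zero_iff.2 <|
      tendsto_hyperbolaSum (abs_parityIndicator_le 1) (abs_parityIndicator_le r)
      (abs_sum_parityIndicator_sub_le one_lt_two) (abs_sum_parityIndicator_sub_le hr)
      (hc 1 one_lt_two) (hc r hr)
  have hG : ∀ r < 2, Tendsto (fun n : ℕ => |∑ a ∈ Finset.Icc 1 n, parityIndicator r a / a -
      1 / 2 * Real.log n - c r|) atTop (𝓝 0) := fun r hr =>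
    tendsto_zero_iff_abs_tendsto_zero _ |>.1 <| tendsto_sub_nhds_zero_iff.2 (hc r hr)
  have hsum := (((hT 0 two_pos).add (hT 1 one_lt_two)).add
    ((hG 0 two_pos).add (hG 1 one_lt_two))).add (tendsto_one_div_atTop_nhds_zero_nat (𝕜 := ℝ))
  simp only [add_zero] at hsum
  refine ⟨fun r => 2 * (τ r - (r : ℝ) / 2 - c (1 - r) / 2 + 1 / 4), ?_⟩
  refine squeeze_zero_norm' ?_ hsum
  filter_upwards [eventually_gt_atTop 0] with k hk
  have hk0 : (0 : ℝ) < k := by exact_mod_cast hk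
  have hQ := stepSum_oddQuotients k
  rw [stepSum_sub (fun k => oddQuotients k - altHarmonic k), stepSum_sub,
    stepSum_mod_two fun r => 2 * (τ r - (r : ℝ) / 2 - c (1 - r) / 2 + 1 / 4), stepSum_altHarmonic,
    altHarmonic_succ, eq_sub_of_add_eq hQ]
  have hpick : ∀ (f : ℕ → ℝ) (r : ℕ), r < 2 → (∀ i, 0 ≤ f i) → f r ≤ f 0 + f 1 := by
    intro f r hr hf
    interval_cases r
    · linarith [hf 1]
    · linarith [hf 0]
  have p1 := hpick (fun r => |hyperbolaSum (parityIndicator 1) (parityIndicator r) k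
      / k - 1 / 4 * Real.log k - τ r|) ((k + 1) % 2) (Nat.mod_lt _ two_pos) fun _ => abs_nonneg _
  have p2 := hpick (fun r => |∑ a ∈ Finset.Icc 1 k, parityIndicator r a / a -
      1 / 2 * Real.log k - c r|) (k % 2) (Nat.mod_lt _ two_pos) fun _ => abs_nonneg _
  have hr : 1 - (k + 1) % 2 = k % 2 := by omega
  have hle : ((k % 2 : ℕ) : ℝ) ≤ 1 := by
    have : k % 2 ≤ 1 := by omega
    exact_mod_cast this
  rw [Real.norm_eq_abs, hr]
  refine le_trans ?_ (add_le_add (add_le_add p1 p2) le_rfl)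
  generalize hyperbolaSum (parityIndicator 1) (parityIndicator ((k + 1) % 2)) k = X
  generalize ∑ a ∈ Finset.Icc 1 k, parityIndicator (k % 2) a / a = Y
  generalize c (k % 2) = cc
  generalize τ ((k + 1) % 2) = t
  generalize (((k + 1) % 2 : ℕ) : ℝ) = u
  have e1 : (X - u * (k / 2) - (k / 2 * Y - k / 4 - (k % 2 : ℕ) / 4) -
      k / 2 * (2 * (t - u / 2 - cc / 2 + 1 / 4))) / k =
      (X / k - 1 / 4 * Real.log k - t) - 1 / 2 * (Y - 1 / 2 * Real.log k - cc) +
        (k % 2 : ℕ) / 4 * (1 / k) := by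
    field_simp
    ring
  rw [e1]
  refine (abs_add_le _ _).trans (add_le_add ((abs_sub _ _).trans (add_le_add le_rfl ?_)) ?_)
  · rw [abs_mul]
    refine mul_le_of_le_one_left (abs_nonneg _) (by norm_num [abs_of_pos])
  · rw [abs_of_nonneg (by positivity)]
    refine mul_le_of_le_one_left (by positivity) (by linarith)

lemma exists_abs_le_of_tendsto_div {f : ℕ → ℝ} (h : Tendsto (fun k : ℕ => f k / k) atTop (𝓝 0))
    {η : ℝ} (hη : 0 < η) : ∃ C, ∀ k : ℕ, |f k| ≤ η * k + C := by
  obtain ⟨N, hN⟩ := eventually_atTop.1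
    ((h.abs.eventually (gt_mem_nhds (by simpa using hη))).and (eventually_gt_atTop 0))
  refine ⟨∑ k ∈ Finset.range N, |f k|, fun k => ?_⟩
  have hpos : 0 ≤ ∑ k ∈ Finset.range N, |f k| := Finset.sum_nonneg fun _ _ => abs_nonneg _
  by_cases hk : k < N
  · have h1 := Finset.single_le_sum (f := fun k => |f k|) (fun _ _ => abs_nonneg _)
      (Finset.mem_range.2 hk)
    have h2 : 0 ≤ η * k := by positivity
    linarith
  · obtain ⟨h1, h2⟩ := hN k (not_lt.1 hk)
    have h3 : (0 : ℝ) < k := by exact_mod_cast h2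
    rw [abs_div, abs_of_pos h3, div_lt_iff₀ h3] at h1
    linarith

lemma tendsto_secondDiffSum {e : ℕ → ℝ}
    (h : Tendsto (fun k : ℕ => stepSum e k / k) atTop (𝓝 0)) :
    Tendsto (fun m : ℕ => (m + 1) * secondDiffSum m e / 2 ^ m) atTop (𝓝 0) := by
  rw [Metric.tendsto_atTop]
  intro ε hε
  obtain ⟨C, hC⟩ := exists_abs_le_of_tendsto_div h (show 0 < ε / 384 by positivity)
  have h1 : Tendsto (fun m : ℕ => 32 * (C ^ 2 / (ε / 384)) / ((m + 2 : ℕ) : ℝ)) atTop (𝓝 0) :=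
    (tendsto_const_div_atTop_nhds_zero_nat _).comp (tendsto_add_atTop_nat 2)
  obtain ⟨N, hN⟩ := eventually_atTop.1 (h1.eventually (gt_mem_nhds (half_pos hε)))
  refine ⟨N, fun m hm => ?_⟩
  have h2 := secondDiffSum_bound e (by positivity) hC m
  have h3 := hN m hm
  push_cast at h3
  rw [Real.dist_eq, sub_zero]
  linarith

lemma tendsto_secondDiffSum_altHarmonic :
    Tendsto (fun m : ℕ => (m + 1) * secondDiffSum m altHarmonic / 2 ^ m) atTop (𝓝 2) := by
  have h1 : Tendsto (fun m : ℕ => 2 / √((m + 2 : ℕ) : ℝ)) atTop (𝓝 0) :=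
    ((Real.tendsto_sqrt_atTop.comp tendsto_natCast_atTop_atTop).const_div_atTop 2).comp
      (tendsto_add_atTop_nat 2)
  have h2 := h1.const_sub 2
  rw [sub_zero] at h2
  refine tendsto_of_tendsto_of_tendsto_of_le_of_le h2 tendsto_const_nhds (fun m => ?_) fun m => ?_
  · have h3 := walkSum_single_zero_le (m + 1)
    have h4 : ((m + 1 : ℕ) : ℝ) + 1 = ((m + 2 : ℕ) : ℝ) := by push_cast; ring
    rw [h4] at h3
    beta_reduce
    rw [secondDiffSum_altHarmonic, le_div_iff₀ (by positivity)]
    have h5 : 2 / √((m + 2 : ℕ) : ℝ) * 2 ^ m = 2 ^ (m + 1) / √((m + 2 : ℕ) : ℝ) := by ring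
    rw [sub_mul, h5, ← pow_succ']
    linarith
  · have h3 : 0 ≤ walkSum (m + 1) fun y => if y = 0 then 1 else 0 := by
      have := walkSum_mono (m := m + 1) (φ := fun _ => 0 * 0)
        (ψ := fun y => if y = 0 then 1 else 0) fun y => by split_ifs <;> norm_num
      rwa [walkSum_const_mul, zero_mul] at this
    beta_reduce
    rw [secondDiffSum_altHarmonic, div_le_iff₀ (by positivity), ← pow_succ']
    linarith

/-- `i_n(132)` is asymptotic to `2^{n−1}/(n+1)`: the limit of
`i_n(132)·(n+1)/2^{n−1}` is `1`. -/
theorem i132_asymptotics :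
    Filter.Tendsto
      (fun n : ℕ => (iNum pattern132 n : ℝ) * ((n : ℝ) + 1) / 2 ^ (n - 1))
      Filter.atTop (nhds 1) := by
  obtain ⟨κ, hκ⟩ := exists_stepSum_sub_isLittleO
  set e : ℕ → ℝ := fun k => oddQuotients k - altHarmonic k - κ (k % 2) with he
  have hsplit : ∀ m, 2 * (iNum pattern132 (m + 1) : ℝ) =
      secondDiffSum m altHarmonic + secondDiffSum m e := by
    intro m
    have h1 : (fun k => (oddQuotients k : ℝ)) =
        fun k => (altHarmonic k + e k) + κ (k % 2) := by
      funext k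
      rw [he]
      ring
    rw [two_mul_iNum, h1, secondDiffSum_add m (fun k => altHarmonic k + e k), secondDiffSum_add,
      secondDiffSum_mod_two, add_zero]
  have hratio : Tendsto (fun m : ℕ => 1 + 1 / ((m : ℝ) + 1)) atTop (𝓝 1) := by
    simpa using tendsto_one_div_add_atTop_nhds_zero_nat.const_add (1 : ℝ)
  have hlim := ((tendsto_secondDiffSum_altHarmonic.add
    (tendsto_secondDiffSum hκ)).div_const 2).mul hratio
  norm_num at hlim
  rw [← tendsto_add_atTop_iff_nat 1]
  refine hlim.congr fun m => ?_
  have h1 : (iNum pattern132 (m + 1) : ℝ) =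
      (secondDiffSum m altHarmonic + secondDiffSum m e) / 2 := by
    rw [← hsplit]
    ring
  rw [h1, add_tsub_cancel_right]
  push_cast
  field_simp
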